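/- arXiv:math/0502269 — 2 statements merged into one kernel-verified Lean document; each statement's English description precedes it below -/
import Mathlib

section
/- Let (W,S) be a Coxeter system satisfying: (1) for each s,t ∈ S such that m(s,t) is odd, {s,t} is a maximal spherical subset of S; (2) there does not exist a three-element subset {s,t,u} ⊆ S such that m(s,t) and m(t,u) are both odd; and (3) for each s,t ∈ S such that m(s,t) is odd, the number of maximal spherical subsets of S intersecting {s,t} is at most two. Then (W,S) is reflection rigid. -/
/-!
In Mathlib's `CoxeterMatrix`, the entry `M i j : ℕ` is the order of `s i * s j`,
with `0` encoding the order `∞`.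
-/

/-- The parabolic subgroup `W_T` of `W` generated by the simple reflections indexed by `T ⊆ S`. -/
def CoxeterSystem.parabolic {B W : Type*} [Group W] {M : CoxeterMatrix B}
    (cs : CoxeterSystem M W) (T : Set B) : Subgroup W :=
  Subgroup.closure (cs.simple '' T)

/-- `T` is a spherical subset of `S`: the parabolic subgroup `W_T` is finite. -/
def CoxeterSystem.IsSpherical {B W : Type*} [Group W] {M : CoxeterMatrix B}
    (cs : CoxeterSystem M W) (T : Set B) : Prop :=
  ((cs.parabolic T : Subgroup W) : Set W).Finite

/-- `T` is a maximal spherical subset of `S`. -/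
def CoxeterSystem.IsMaxSpherical {B W : Type*} [Group W] {M : CoxeterMatrix B}
    (cs : CoxeterSystem M W) (T : Set B) : Prop :=
  cs.IsSpherical T ∧ ∀ U : Set B, cs.IsSpherical U → T ⊆ U → U = T

universe u v w

/-- `(W, S)` is reflection rigid: for every Coxeter system `(W, S')` on the same group `W`
whose set of reflections coincides with that of `(W, S)`, there is a bijection `ψ : S → S'`
with `m (s, t) = m' (ψ s, ψ t)` for all `s, t ∈ S`. -/
def CoxeterSystem.ReflectionRigid {B : Type u} {W : Type w} [Group W] {M : CoxeterMatrix B}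
    (cs : CoxeterSystem M W) : Prop :=
  ∀ (B' : Type v) (_ : Finite B') (M' : CoxeterMatrix B') (cs' : CoxeterSystem M' W),
    (∀ w : W, cs.IsReflection w ↔ cs'.IsReflection w) →
    ∃ ψ : B ≃ B', ∀ i j : B, M i j = M' (ψ i) (ψ j)

set_option linter.unusedSimpArgs false
set_option linter.unusedVariables false
set_option linter.unusedSectionVars false
namespace RR

section Refl
variable {R V : Type*} [CommRing R] [AddCommGroup V] [Module R V]

/-- The reflection `x ↦ x - F x v • v`. -/
noncomputable def refl (F : LinearMap.BilinForm R V) (v : V) : Module.End R V :=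
  LinearMap.id - (F.flip v).smulRight v

lemma refl_apply (F : LinearMap.BilinForm R V) (v x : V) : refl F v x = x - F x v • v := by
  simp [refl]

variable {F : LinearMap.BilinForm R V} (hF : ∀ x y, F x y = F y x)
include hF

omit hF in
lemma refl_mul_self {v : V} (hv : F v v = 2) : refl F v * refl F v = 1 := by
  ext x
  simp only [Module.End.mul_apply, refl_apply, Module.End.one_apply, map_sub, map_smul,
    LinearMap.sub_apply, LinearMap.smul_apply, hv, smul_eq_mul]
  module

lemma refl_isom {v : V} (hv : F v v = 2) (x y : V) : F (refl F v x) (refl F v y) = F x y := by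
  simp only [refl_apply, map_sub, map_smul,
    LinearMap.sub_apply, LinearMap.smul_apply, hv, smul_eq_mul]
  rw [hF v y]; ring

omit hF in
lemma isom_mul_refl {g : Module.End R V} (hg : ∀ x y, F (g x) (g y) = F x y) (v : V) :
    g * refl F v = refl F (g v) * g := by
  ext x
  simp [refl_apply, hg]

/-- The rotation orbit. -/
noncomputable def seqY (c : R) (a b : V) : ℕ → V
  | 0 => a
  | 1 => b
  | (k+2) => c • seqY c a b (k+1) - seqY c a b k

lemma refl_mul_refl_seqY {a b : V} (ha : F a a = 2) (hb : F b b = 2) (k : ℕ) :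
    (refl F a * refl F b) (seqY (F a b) a b (k+2)) = seqY (F a b) a b k := by
  have h0 : (refl F a * refl F b) (seqY (F a b) a b 2) = a := by
    simp only [seqY, Module.End.mul_apply, refl_apply, map_sub, map_smul,
      LinearMap.sub_apply, LinearMap.smul_apply, ha, hb, smul_eq_mul, hF b a]
    module
  have h1 : (refl F a * refl F b) (seqY (F a b) a b 3) = b := by
    simp only [seqY, Module.End.mul_apply, refl_apply, map_sub, map_smul,
      LinearMap.sub_apply, LinearMap.smul_apply, ha, hb, smul_eq_mul, hF b a]
    module
  have key : ∀ k, (refl F a * refl F b) (seqY (F a b) a b (k+2)) = seqY (F a b) a b k ∧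
      (refl F a * refl F b) (seqY (F a b) a b (k+3)) = seqY (F a b) a b (k+1) := by
    intro k
    induction k with
    | zero => exact ⟨h0, h1⟩
    | succ k ih =>
      refine ⟨ih.2, ?_⟩
      rw [show seqY (F a b) a b (k+1+3) = F a b • seqY (F a b) a b (k+3) - seqY (F a b) a b (k+2)
        from rfl, map_sub, map_smul, ih.1, ih.2]
      rfl
  exact (key k).1

lemma refl_pow_seqY {a b : V} (ha : F a a = 2) (hb : F b b = 2) (m k : ℕ) :
    ((refl F a * refl F b) ^ m) (seqY (F a b) a b (k+2*m)) = seqY (F a b) a b k := by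
  induction m generalizing k with
  | zero => simp
  | succ m ih =>
    rw [pow_succ, Module.End.mul_apply, show k + 2*(m+1) = (k + 2*m) + 2 by ring,
      refl_mul_refl_seqY hF ha hb, ih]

/-- Chebyshev polynomials. -/
noncomputable def cheb : ℕ → Polynomial ℝ
  | 0 => Polynomial.C 2
  | 1 => Polynomial.X
  | (k+2) => Polynomial.X * cheb (k+1) - cheb k

omit hF in
lemma cheb_deg (k : ℕ) : (cheb (k+1)).Monic ∧ (cheb (k+1)).natDegree = k+1 ∧
    (cheb k).natDegree ≤ k := by
  induction k with
  | zero => simp [cheb, Polynomial.monic_X]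
  | succ k ih =>
    obtain ⟨h1, h2, h3⟩ := ih
    have hm : (Polynomial.X * cheb (k+1)).Monic := Polynomial.monic_X.mul h1
    have hd : (Polynomial.X * cheb (k+1)).natDegree = k+2 := by
      rw [Polynomial.natDegree_X_mul h1.ne_zero, h2]
    have hlt : (cheb k).degree < (Polynomial.X * cheb (k+1)).degree := by
      rw [Polynomial.degree_eq_natDegree hm.ne_zero, hd]
      refine lt_of_le_of_lt Polynomial.degree_le_natDegree ?_
      exact_mod_cast (by omega)
    refine ⟨hm.sub_of_left hlt, ?_, h2.le⟩
    rw [show cheb (k+1+1) = Polynomial.X * cheb (k+1) - cheb k from rfl]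
    rw [Polynomial.natDegree_sub_eq_left_of_natDegree_lt (by omega), hd]

lemma seqY_cheb [Algebra ℝ R] {a b : V} (ha : F a a = 2) (k : ℕ) :
    F (seqY (F a b) a b k) a = Polynomial.aeval (F a b) (cheb k) := by
  have : ∀ k, F (seqY (F a b) a b k) a = Polynomial.aeval (F a b) (cheb k) ∧
    F (seqY (F a b) a b (k+1)) a = Polynomial.aeval (F a b) (cheb (k+1)) := by
    intro k
    induction k with
    | zero =>
      have h2 : algebraMap ℝ R 2 = 2 := map_ofNat (algebraMap ℝ R) 2
      simp [seqY, cheb, ha, hF b a, h2]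
    | succ k ih =>
      refine ⟨ih.2, ?_⟩
      simp only [seqY, cheb, map_sub, map_smul, LinearMap.sub_apply, LinearMap.smul_apply,
        ih.1, ih.2, smul_eq_mul, map_mul, Polynomial.aeval_X]
  exact (this k).1

lemma finite_order_cheb [Algebra ℝ R] {a b : V} (ha : F a a = 2) (hb : F b b = 2) {m : ℕ}
    (h : (refl F a * refl F b) ^ m = 1) :
    Polynomial.aeval (F a b) (cheb (2*m) - Polynomial.C 2) = 0 := by
  have := refl_pow_seqY hF ha hb m 0
  rw [h, zero_add] at this
  have h2 := seqY_cheb (b := b) hF ha (2*m)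
  rw [show seqY (F a b) a b (2*m) = a from this, ha] at h2
  have h3 : algebraMap ℝ R 2 = 2 := map_ofNat (algebraMap ℝ R) 2
  simp [← h2, h3]

omit hF in
lemma cheb_ne {m : ℕ} (hm : m ≠ 0) : cheb (2*m) - Polynomial.C 2 ≠ 0 := by
  intro h
  have h1 := (cheb_deg (2*m-1)).2.1
  rw [show 2*m-1+1 = 2*m by omega, sub_eq_zero.1 h] at h1
  have : (Polynomial.C (2 : ℝ)).natDegree = 0 := Polynomial.natDegree_C 2
  omega

end Refl

lemma const_of_aeval {σ : Type*} (c : MvPolynomial σ ℝ) (P : Polynomial ℝ) (hP : P ≠ 0)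
    (h : Polynomial.aeval c P = 0) : ∃ r : ℝ, c = MvPolynomial.C r := by
  have : ∏ r ∈ P.roots.toFinset, (c - MvPolynomial.C r) = 0 := by
    apply MvPolynomial.funext
    intro x
    rw [map_prod, map_zero, Finset.prod_eq_zero_iff]
    refine ⟨MvPolynomial.eval x c, ?_, by simp⟩
    rw [Multiset.mem_toFinset, Polynomial.mem_roots hP, Polynomial.IsRoot]
    have h2 := congrArg (MvPolynomial.aeval x) h
    rw [← Polynomial.aeval_algHom_apply, map_zero] at h2
    rw [← Polynomial.coe_aeval_eq_eval]
    exact h2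
  rw [Finset.prod_eq_zero_iff] at this
  obtain ⟨r, -, hr⟩ := this
  exact ⟨r, sub_eq_zero.1 hr⟩

lemma const_of_finite_order {σ V : Type*} [AddCommGroup V] [Module (MvPolynomial σ ℝ) V]
    {F : LinearMap.BilinForm (MvPolynomial σ ℝ) V} (hF : ∀ x y, F x y = F y x)
    {a b : V} (ha : F a a = 2) (hb : F b b = 2) {m : ℕ} (hm : m ≠ 0)
    (h : (refl F a * refl F b) ^ m = 1) : ∃ r : ℝ, F a b = MvPolynomial.C r :=
  const_of_aeval _ _ (cheb_ne hm) (finite_order_cheb hF ha hb h)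

section Cos
variable {R V : Type*} [CommRing R] [Algebra ℝ R] [AddCommGroup V] [Module R V]
variable {F : LinearMap.BilinForm R V} (hF : ∀ x y, F x y = F y x)
include hF

lemma refl_pow_zero {a b : V} (ha : F a a = 2) (hb : F b b = 2) (hab : F a b = 0) {m : ℕ}
    (hm : Even m) : (refl F a * refl F b) ^ m = 1 := by
  obtain ⟨k, rfl⟩ := hm
  have : (refl F a * refl F b) ^ 2 = 1 := by
    have hc : refl F a * refl F b = refl F b * refl F a := by
      ext x
      simp only [Module.End.mul_apply, refl_apply, map_sub, map_smul,
        LinearMap.sub_apply, LinearMap.smul_apply, hF b a, hab, smul_eq_mul]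
      module
    rw [pow_two]
    nth_rewrite 2 [hc]
    rw [mul_assoc, ← mul_assoc (refl F b), refl_mul_self hb, one_mul, refl_mul_self ha]
  rw [← two_mul, pow_mul, this, one_pow]

lemma refl_pow_cos {a b : V} (ha : F a a = 2) (hb : F b b = 2) {m : ℕ} (hm : 2 ≤ m)
    (hab : F a b = algebraMap ℝ R (-2 * Real.cos (Real.pi / m))) :
    (refl F a * refl F b) ^ m = 1 := by
  have hsin : ∀ x y : ℝ, Real.sin (x + y) = 2 * Real.cos y * Real.sin x - Real.sin (x - y) := by
    intro x y; rw [Real.sin_add, Real.sin_sub]; ring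
  set φ : ℝ := Real.pi - Real.pi / m with hφ
  have hm0 : (m : ℝ) ≠ 0 := by positivity
  have hc : -2 * Real.cos (Real.pi / m) = 2 * Real.cos φ := by rw [hφ, Real.cos_pi_sub]; ring
  have hs : 0 < Real.sin φ := by
    rw [hφ, Real.sin_pi_sub]
    apply Real.sin_pos_of_pos_of_lt_pi
    · positivity
    · apply div_lt_self Real.pi_pos; exact_mod_cast (by omega)
  have key : ∀ k : ℕ, algebraMap ℝ R (Real.sin φ) • seqY (F a b) a b k =
      algebraMap ℝ R (Real.sin (k * φ)) • b - algebraMap ℝ R (Real.sin (k * φ - φ)) • a ∧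
      algebraMap ℝ R (Real.sin φ) • seqY (F a b) a b (k+1) =
      algebraMap ℝ R (Real.sin ((k+1) * φ)) • b - algebraMap ℝ R (Real.sin (k * φ)) • a := by
    intro k
    induction k with
    | zero => simp [seqY]
    | succ k ih =>
      obtain ⟨i1, i2⟩ := ih
      refine ⟨?_, ?_⟩
      · rw [i2]; push_cast
        rw [show ((k:ℝ)+1) * φ - φ = k * φ by ring]
      · rw [show seqY (F a b) a b (k+1+1) = F a b • seqY (F a b) a b (k+1) - seqY (F a b) a b k
          from rfl, smul_sub, smul_comm, i1, i2, hab, hc]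
        have e1 : Real.sin ((((k+1:ℕ):ℝ)+1) * φ) = 2 * Real.cos φ * Real.sin ((k+1) * φ)
            - Real.sin (k*φ) := by
          have := hsin ((k+1)*φ) φ
          push_cast
          rw [show ((k:ℝ)+1+1) * φ = (k+1)*φ + φ by ring, this,
            show ((k:ℝ)+1)*φ - φ = k * φ by ring]
        have e2 : Real.sin (((k+1:ℕ):ℝ) * φ) = 2 * Real.cos φ * Real.sin (k * φ)
            - Real.sin (k*φ-φ) := by
          push_cast
          rw [show ((k:ℝ)+1) * φ = k*φ + φ by ring, hsin]
        rw [e1, e2]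
        simp only [map_sub, map_mul]
        module
  have hu : ∀ x y : V, algebraMap ℝ R (Real.sin φ) • x = algebraMap ℝ R (Real.sin φ) • y → x = y := by
    intro x y h
    have h2 := congrArg (fun z => algebraMap ℝ R (Real.sin φ)⁻¹ • z) h
    simpa [smul_smul, ← map_mul, inv_mul_cancel₀ hs.ne'] using h2
  have hper : (2*m : ℕ) * φ = (m - 1 : ℕ) * (2 * Real.pi) := by
    rw [hφ, Nat.cast_sub (by omega)]; push_cast; field_simp
  have hy0 : seqY (F a b) a b (0 + 2*m) = a := by
    apply hu
    rw [(key _).1, zero_add, hper]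
    rw [Real.sin_nat_mul_two_pi_sub]
    have : Real.sin ((m - 1 : ℕ) * (2 * Real.pi)) = 0 := by
      have := Real.sin_nat_mul_pi ((m-1)*2)
      push_cast at this ⊢
      rw [← this]; ring_nf
    rw [this]; simp
  have hy1 : seqY (F a b) a b (1 + 2*m) = b := by
    apply hu
    rw [add_comm 1, (key _).2, add_mul, hper]
    have : Real.sin ((m - 1 : ℕ) * (2 * Real.pi)) = 0 := by
      have := Real.sin_nat_mul_pi ((m-1)*2)
      push_cast at this ⊢
      rw [← this]; ring_nf
    rw [this, add_comm, one_mul, Real.sin_add_nat_mul_two_pi]; simp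
  have ha' : ((refl F a * refl F b) ^ m) a = a := by
    have := refl_pow_seqY hF ha hb m 0
    rwa [hy0] at this
  have hb' : ((refl F a * refl F b) ^ m) b = b := by
    have := refl_pow_seqY hF ha hb m 1
    rwa [hy1] at this
  have horth : ∀ x, F x a = 0 → F x b = 0 → ((refl F a * refl F b) ^ m) x = x := by
    intro x h1 h2
    have : (refl F a * refl F b) x = x := by simp [refl_apply, h1, h2]
    generalize refl F a * refl F b = T at *
    induction m with
    | zero => simp
    | succ m ih => 
      clear * - this
      induction (m+1) with
      | zero => simp
      | succ k ih => rw [pow_succ, Module.End.mul_apply, this, ih]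
  -- decompose
  ext x
  rw [Module.End.one_apply]
  set d : R := algebraMap ℝ R (4 * Real.sin φ ^2) with hd
  have hdd : d = 4 - F a b ^ 2 := by
    rw [hd, hab, hc, Real.sin_sq]; simp only [map_mul, map_sub, map_pow, map_one, map_ofNat]; ring
  have hdi : d * algebraMap ℝ R (4 * Real.sin φ ^2)⁻¹ = 1 := by
    rw [hd, ← map_mul, mul_inv_cancel₀ (by positivity), map_one]
  -- d x = z + p a + q b
  have hdx : d • x = (d • x - (2 * F x a - F a b * F x b) • a - (2 * F x b - F a b * F x a) • b)
    + (2 * F x a - F a b * F x b) • a + (2 * F x b - F a b * F x a) • b := by module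
  have h3 : ((refl F a * refl F b) ^ m) (d • x) = d • x := by
    rw [hdx, map_add, map_add, map_smul, map_smul, ha', hb', horth]
    · simp only [map_sub, map_smul, LinearMap.sub_apply, LinearMap.smul_apply, ha, hb, hF b a,
        smul_eq_mul, hdd]
      ring
    · simp only [map_sub, map_smul, LinearMap.sub_apply, LinearMap.smul_apply, ha, hb, hF b a,
        smul_eq_mul, hdd]
      ring
  have h4 := congrArg (fun z => algebraMap ℝ R (4 * Real.sin φ ^2)⁻¹ • z) h3
  simp only [map_smul, smul_smul, mul_comm _ d, hdi, one_smul] at h4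
  exact h4

end Cos
end RR

namespace RR

section Basic
variable {B W : Type*} [Group W] {M : CoxeterMatrix B} (cs : CoxeterSystem M W)

/-- Conjugacy class of a simple reflection. -/
def cl (i : B) : ConjClasses W := ConjClasses.mk (cs.simple i)

lemma cl_eq_iff {B' : Type*} {M' : CoxeterMatrix B'} (cs' : CoxeterSystem M' W) (i : B) (j : B') :
    cl cs i = cl cs' j ↔ IsConj (cs.simple i) (cs'.simple j) :=
  ConjClasses.mk_eq_mk_iff_isConj

lemma cl_eq_of_odd {i j : B} (h : Odd (M i j)) : cl cs i = cl cs j := by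
  rw [cl_eq_iff, isConj_iff]
  obtain ⟨l, hl⟩ := h
  have hT := cs.simple_mul_simple_pow i j
  rw [hl] at hT
  have hi := cs.simple_mul_simple_self i
  have hj := cs.simple_mul_simple_self j
  have key : ∀ k : ℕ, (cs.simple i * cs.simple j)^k * cs.simple i =
      cs.simple i * ((cs.simple i * cs.simple j)^k)⁻¹ := by
    intro k
    induction k with
    | zero => simp
    | succ k ih =>
      have h1 : ((cs.simple i * cs.simple j) ^ (k+1))⁻¹ =
        cs.simple j * cs.simple i * ((cs.simple i * cs.simple j) ^ k)⁻¹ := by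
        rw [pow_succ, mul_inv_rev, mul_inv_rev, cs.inv_simple, cs.inv_simple]
      rw [h1, pow_succ', mul_assoc, ih]; group
  refine ⟨(cs.simple i * cs.simple j)^l, ?_⟩
  rw [key, mul_assoc, ← mul_inv_rev, ← pow_add]
  have h2 : ((cs.simple i * cs.simple j) ^ (l+l))⁻¹ = cs.simple i * cs.simple j := by
    rw [inv_eq_iff_mul_eq_one, ← pow_succ, ← hT]; congr 1; ring
  rw [h2, ← mul_assoc, hi, one_mul]

lemma parity {P : B → Prop} (hP : ∀ i j, P i → Odd (M i j) → P j) {i j : B} (hi : P i)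
    (h : cl cs i = cl cs j) : P j := by
  classical
  by_contra hj
  have hl : CoxeterMatrix.IsLiftable M (fun i => if P i then (-1 : ℤˣ) else 1) := by
    intro a b
    by_cases ha : P a <;> by_cases hb : P b
    · simp [ha, hb]
    · have : ¬ Odd (M a b) := fun h => hb (hP _ _ ha h)
      rw [Nat.not_odd_iff_even] at this
      simp [ha, hb, this.neg_one_pow]
    · have : ¬ Odd (M a b) := fun h => ha (hP _ _ hb (by rwa [M.symmetric]))
      rw [Nat.not_odd_iff_even] at this
      simp [ha, hb, this.neg_one_pow]
    · simp [ha, hb]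
  rw [cl_eq_iff] at h
  have h2 := (cs.lift ⟨_, hl⟩).map_isConj h
  rw [isConj_iff_eq, cs.lift_apply_simple, cs.lift_apply_simple] at h2
  simp [hi, hj] at h2

lemma exists_odd {i j : B} (hij : i ≠ j) (h : cl cs i = cl cs j) : ∃ k, k ≠ i ∧ Odd (M i k) := by
  by_contra hc
  push Not at hc
  refine hij (parity cs (P := fun a => i = a) ?_ rfl h)
  rintro _ b rfl hb
  by_contra hne
  exact hc b (Ne.symm hne) hb

end Basic

section Rep
variable {B W : Type*} [Group W] {M : CoxeterMatrix B} (cs : CoxeterSystem M W)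
variable {R V : Type*} [CommRing R] [AddCommGroup V] [Module R V]

/-- A reflection representation. -/
structure IsRep (F : LinearMap.BilinForm R V) (K : ConjClasses W → Prop) (α : B → V)
    (ρ : W →* Module.End R V) : Prop where
  sym : ∀ x y, F x y = F y x
  norm : ∀ i, F (α i) (α i) = 2
  kept : ∀ i, K (cl cs i) → ρ (cs.simple i) = refl F (α i)
  kill : ∀ i, ¬ K (cl cs i) → ρ (cs.simple i) = 1

lemma exists_rep {F : LinearMap.BilinForm R V} (K : ConjClasses W → Prop) (α : B → V)
    (sym : ∀ x y, F x y = F y x) (norm : ∀ i, F (α i) (α i) = 2)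
    (hfin : ∀ i j, K (cl cs i) → K (cl cs j) → i ≠ j → M i j ≠ 0 →
      (refl F (α i) * refl F (α j)) ^ M i j = 1) :
    ∃ ρ, IsRep cs F K α ρ := by
  classical
  have hl : CoxeterMatrix.IsLiftable M
      (fun i => if K (cl cs i) then refl F (α i) else (1 : Module.End R V)) := by
    intro i j
    have hev : ∀ i j, K (cl cs i) → ¬ K (cl cs j) → (refl F (α i)) ^ M i j = 1 := by
      intro i j hi hj
      have : ¬ Odd (M i j) := fun h => hj (cl_eq_of_odd cs h ▸ hi)
      rw [Nat.not_odd_iff_even] at this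
      obtain ⟨k, hk⟩ := this
      rw [hk, ← two_mul, pow_mul, pow_two, refl_mul_self (norm i), one_pow]
    by_cases hi : K (cl cs i) <;> by_cases hj : K (cl cs j)
    · simp only [hi, hj, if_true]
      by_cases hij : i = j
      · subst hij; rw [refl_mul_self (norm i), one_pow]
      by_cases h0 : M i j = 0
      · rw [h0, pow_zero]
      exact hfin i j hi hj hij h0
    · simp [hi, hj, hev]
    · simp [hi, hj, M.symmetric i j, hev]
    · simp [hi, hj]
  refine ⟨cs.lift ⟨_, hl⟩, sym, norm, ?_, ?_⟩
  · intro i hi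
    rw [cs.lift_apply_simple]; simp [hi]
  · intro i hi
    rw [cs.lift_apply_simple]; simp [hi]

variable {cs}
variable {F : LinearMap.BilinForm R V} {K : ConjClasses W → Prop} {α : B → V}
    {ρ : W →* Module.End R V} (h : IsRep cs F K α ρ)
include h

lemma IsRep.isom (w : W) : ∀ x y, F (ρ w x) (ρ w y) = F x y := by
  induction w using cs.simple_induction with
  | simple i =>
    by_cases hi : K (cl cs i)
    · rw [h.kept i hi]; exact refl_isom h.sym (h.norm i)
    · rw [h.kill i hi]; simp
  | one => simp
  | mul w w' h1 h2 => intro x y; simp [h1, h2]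

lemma IsRep.root {r : W} {i : B} (hr : ConjClasses.mk r = cl cs i) (hK : K (cl cs i)) :
    ∃ w, ρ r = refl F (ρ w (α i)) ∧ F (ρ w (α i)) (ρ w (α i)) = 2 := by
  rw [cl, ConjClasses.mk_eq_mk_iff_isConj] at hr
  obtain ⟨w, hw⟩ := isConj_iff.1 hr.symm
  refine ⟨w, ?_, by rw [h.isom, h.norm]⟩
  rw [← hw, map_mul, map_mul, h.kept i hK, isom_mul_refl (h.isom w), mul_assoc, ← map_mul]
  simp

lemma IsRep.kill' {r : W} {i : B} (hr : ConjClasses.mk r = cl cs i) (hK : ¬ K (cl cs i)) :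
    ρ r = 1 := by
  rw [cl, ConjClasses.mk_eq_mk_iff_isConj] at hr
  obtain ⟨w, hw⟩ := isConj_iff.1 hr.symm
  rw [← hw, map_mul, map_mul, h.kill i hK, mul_one, ← map_mul]
  simp

/-- Invariance of a set under the group, from the generators. -/
lemma IsRep.stable {N : Set V} (hN : ∀ i, K (cl cs i) → ∀ x ∈ N, refl F (α i) x ∈ N) (w : W) :
    ∀ x ∈ N, ρ w x ∈ N := by
  induction w using cs.simple_induction with
  | simple i =>
    by_cases hi : K (cl cs i)
    · rw [h.kept i hi]; exact hN i hi
    · rw [h.kill i hi]; simp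
  | one => simp
  | mul w w' h1 h2 => 
    intro x hx
    rw [map_mul, Module.End.mul_apply]
    exact h1 _ (h2 _ hx)

omit h in
lemma refl_inj [IsDomain R] [Algebra ℝ R] (sym : ∀ x y, F x y = F y x) {u v : V}
    (hu : F u u = 2) (hv : F v v = 2)
    (huv : refl F u = refl F v) : u = v ∨ u = - v := by
  have h1 := congrArg (fun T => T u) huv
  simp only [refl_apply, hu] at h1
  have h2 : (2 : R) • u = F u v • v := by
    have : (2:R) • u = u - (u - (2:R) • u) := by abel
    rw [this, h1]; abel
  have h3 : (2:R) * 2 = F u v * F u v := by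
    have := congrArg (fun x => F u x) h2
    simpa [hu] using this
  have hinv : algebraMap ℝ R (1/2) * 2 = 1 := by
    rw [show (2 : R) = algebraMap ℝ R 2 from (map_ofNat (algebraMap ℝ R) 2).symm, ← map_mul]
    norm_num
  have h4 : F u v = 2 ∨ F u v = -2 := by
    have : (F u v - 2) * (F u v + 2) = 0 := by linear_combination - h3
    rcases mul_eq_zero.1 this with h | h
    · left; linear_combination h
    · right; linear_combination h
  have h5 : u = (algebraMap ℝ R (1/2) * F u v) • v := by
    rw [mul_smul, ← h2, smul_smul, hinv, one_smul]
  rcases h4 with h | h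
  · left; rw [h5, h, hinv, one_smul]
  · right; rw [h5, h, mul_neg, hinv, neg_smul, one_smul]

lemma IsRep.mem_of_stable [IsDomain R] [Algebra ℝ R] {B' : Type*} {M' : CoxeterMatrix B'}
    (cs' : CoxeterSystem M' W)
    (hc : ∀ i, ∃ i', cl cs i = cl cs' i') (v : B' → V) (hv : ∀ i', F (v i') (v i') = 2)
    (hv' : ∀ i', K (cl cs' i') → ρ (cs'.simple i') = refl F (v i'))
    (hk : ∀ i', ¬ K (cl cs' i') → ρ (cs'.simple i') = 1)
    {N : Set V} (h1 : ∀ i', K (cl cs' i') → v i' ∈ N) (h2 : ∀ x ∈ N, - x ∈ N)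
    (h3 : ∀ i', K (cl cs' i') → ∀ x ∈ N, x - F x (v i') • v i' ∈ N) (i : B) (hi : K (cl cs i)) :
    α i ∈ N := by
  have h' : IsRep cs' F K v ρ := ⟨h.sym, hv, hv', hk⟩
  obtain ⟨i', hi'⟩ := hc i
  obtain ⟨w, hw, hw2⟩ := h'.root (r := cs.simple i) hi' (hi' ▸ hi)
  have hmem : ρ w (v i') ∈ N := by
    refine h'.stable ?_ w _ (h1 i' (hi' ▸ hi))
    intro j hj x hx
    rw [refl_apply]; exact h3 j hj x hx
  rw [h.kept i hi] at hw
  rcases refl_inj h.sym (h.norm i) hw2 hw with h | h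
  · rwa [h]
  · rw [h]; exact h2 _ hmem

/-- roots of the simple reflections of another system -/
lemma IsRep.exists_roots {B' : Type*} {M' : CoxeterMatrix B'}
    (cs' : CoxeterSystem M' W) (hc : ∀ i', ∃ i, cl cs' i' = cl cs i) :
    ∃ v : B' → V, IsRep cs' F K v ρ := by
  have : ∀ i', ∃ v : V, F v v = 2 ∧ (K (cl cs' i') → ρ (cs'.simple i') = refl F v) := by
    intro i'
    obtain ⟨i, hi⟩ := hc i'
    by_cases hK : K (cl cs i)
    · obtain ⟨w, h1, h2⟩ := h.root (r := cs'.simple i') hi hK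
      exact ⟨_, h2, fun _ => h1⟩
    · exact ⟨α i, h.norm i, fun h => absurd (hi ▸ h) hK⟩
  choose v hv1 hv2 using this
  refine ⟨v, h.sym, hv1, hv2, ?_⟩
  intro i' hK
  obtain ⟨i, hi⟩ := hc i'
  exact h.kill' (r := cs'.simple i') hi (hi ▸ hK)

end Rep

section Gen
variable {B W : Type*} [Group W] {M : CoxeterMatrix B} (cs : CoxeterSystem M W) [Fintype B]
  [DecidableEq B]
variable {R : Type*} [CommRing R] [Algebra ℝ R]

/-- Generic Gram matrix. -/
noncomputable def gram (M : CoxeterMatrix B) (Y : B → B → R) : Matrix B B R :=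
  fun i j => if i = j then 2 else if M i j ≠ 0 then algebraMap ℝ R (-2 * Real.cos (Real.pi / M i j))
    else Y i j

lemma gram_symm (Y : B → B → R) (hY : ∀ i j, Y i j = Y j i) (i j : B) :
    gram M Y i j = gram M Y j i := by
  simp only [gram, M.symmetric i j, hY i j, eq_comm (a := i)]

lemma toBilin'_sym {n : Type*} [Fintype n] [DecidableEq n] (A : Matrix n n R)
    (hA : ∀ i j, A i j = A j i) (x y : n → R) :
    Matrix.toBilin' A x y = Matrix.toBilin' A y x := by
  rw [Matrix.toBilin'_apply, Matrix.toBilin'_apply, Finset.sum_comm]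
  refine Finset.sum_congr rfl fun i _ => Finset.sum_congr rfl fun j _ => ?_
  rw [hA]; ring

lemma exists_gen_rep (K : ConjClasses W → Prop) (Y : B → B → R) (hY : ∀ i j, Y i j = Y j i) :
    ∃ ρ, IsRep cs (Matrix.toBilin' (gram M Y)) K (fun i => Pi.single i (1 : R)) ρ := by
  have hsym := toBilin'_sym (gram M Y) (gram_symm Y hY)
  have hn : ∀ i : B, Matrix.toBilin' (gram M Y) (Pi.single i (1 : R)) (Pi.single i 1) = 2 := by
    intro i; rw [Matrix.toBilin'_single]; simp [gram]
  refine exists_rep cs K _ hsym hn ?_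
  intro i j _ _ hij h0
  apply refl_pow_cos hsym (hn i) (hn j)
  · have : M i j ≠ 1 := M.off_diagonal i j hij
    omega
  · rw [Matrix.toBilin'_single]; simp [gram, hij, h0]

end Gen
end RR

namespace RR

lemma span_pair {R V : Type*} [CommRing R] [Algebra ℝ R] [AddCommGroup V] [Module R V]
    (F : LinearMap.BilinForm R V) (A : Subalgebra ℝ R) (S : Set V)
    (hS : ∀ x ∈ S, ∀ y ∈ S, F x y ∈ A) :
    ∀ x ∈ Submodule.span A S, ∀ y ∈ Submodule.span A S, F x y ∈ A := by
  intro x hx y hy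
  induction hx, hy using Submodule.span_induction₂ with
  | mem_mem x y hx hy => exact hS x hx y hy
  | zero_left y hy => simp
  | zero_right x hx => simp
  | add_left x y z _ _ _ h1 h2 => rw [map_add, LinearMap.add_apply]; exact A.add_mem h1 h2
  | add_right x y z _ _ _ h1 h2 => rw [map_add]; exact A.add_mem h1 h2
  | smul_left r x y _ _ h => 
    rw [Subalgebra.smul_def, map_smul, LinearMap.smul_apply]; exact A.mul_mem r.2 h
  | smul_right r x y _ _ h => 
    rw [Subalgebra.smul_def, map_smul]; exact A.mul_mem r.2 h

section Two
variable {B B' W : Type*} [Group W] {M : CoxeterMatrix B} (cs : CoxeterSystem M W)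
  {M' : CoxeterMatrix B'} (cs' : CoxeterSystem M' W) [Finite B] [Finite B']

lemma size_le (hc : ∀ i, ∃ i', cl cs i = cl cs' i') (hc' : ∀ i', ∃ i, cl cs' i' = cl cs i)
    (C : ConjClasses W) :
    Nat.card {i // cl cs i = C} ≤ Nat.card {i' // cl cs' i' = C} := by
  classical
  have := Fintype.ofFinite B
  have := Fintype.ofFinite B'
  obtain ⟨ρ, h⟩ := exists_gen_rep cs (R := ℝ) (fun D => D = C) (fun _ _ => 0) (fun _ _ => rfl)
  obtain ⟨v, hv⟩ := h.exists_roots cs' hc'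
  have hmem : ∀ i : {i // cl cs i = C}, (Pi.single i.1 (1:ℝ) : B → ℝ) ∈
      Submodule.span ℝ (Set.range (fun i' : {i' // cl cs' i' = C} => v i'.1)) := by
    intro i
    refine h.mem_of_stable cs' hc v hv.norm hv.kept hv.kill
      (N := (Submodule.span ℝ (Set.range (fun i' : {i' // cl cs' i' = C} => v i'.1)) :
        Set (B → ℝ))) ?_ ?_ ?_ i.1 i.2
    · intro i' hi'
      exact Submodule.subset_span ⟨⟨i', hi'⟩, rfl⟩
    · intro x hx; exact Submodule.neg_mem _ hx
    · intro i' hi' x hx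
      exact Submodule.sub_mem _ hx (Submodule.smul_mem _ _ (Submodule.subset_span ⟨⟨i', hi'⟩, rfl⟩))
  have hli : LinearIndependent ℝ (fun i : {i // cl cs i = C} => (Pi.single i.1 (1:ℝ) : B → ℝ)) :=
    (Pi.linearIndependent_single_one B ℝ).comp _ Subtype.val_injective
  have := linearIndependent_le_span_aux' _ hli _ (by rintro _ ⟨i, rfl⟩; exact hmem i)
  rw [Nat.card_eq_fintype_card, Nat.card_eq_fintype_card]
  exact this.trans (by rw [← Nat.card_eq_fintype_card, ← Nat.card_eq_fintype_card]; exact Finite.card_range_le _)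

lemma cross_le (hc : ∀ i, ∃ i', cl cs i = cl cs' i') (hc' : ∀ i', ∃ i, cl cs' i' = cl cs i)
    {C D : ConjClasses W} (hCD : C ≠ D)
    (hC : ∀ i' j', cl cs' i' = C → cl cs' j' = C → M' i' j' ≠ 0)
    (hD : ∀ i' j', cl cs' i' = D → cl cs' j' = D → M' i' j' ≠ 0) :
    Nat.card {p : B × B // cl cs p.1 = C ∧ cl cs p.2 = D ∧ M p.1 p.2 = 0} ≤
    Nat.card {p : B' × B' // cl cs' p.1 = C ∧ cl cs' p.2 = D ∧ M' p.1 p.2 = 0} := by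
  classical
  have := Fintype.ofFinite B
  have := Fintype.ofFinite B'
  set Y : B → B → MvPolynomial (B × B) ℝ := fun i j =>
    if cl cs i = C ∧ cl cs j = D then MvPolynomial.X (i, j) else
    if cl cs j = C ∧ cl cs i = D then MvPolynomial.X (j, i) else 0 with hYdef
  have hY : ∀ i j, Y i j = Y j i := by
    intro i j
    simp only [hYdef]
    by_cases h1 : cl cs i = C ∧ cl cs j = D
    · have h2 : ¬ (cl cs j = C ∧ cl cs i = D) := fun h2 => hCD (h1.1.symm.trans h2.2)
      simp only [h1, h2, if_true, if_false, and_self, and_true, hCD, hCD.symm]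
    · by_cases h2 : (cl cs j = C ∧ cl cs i = D)
      · simp [h1, h2, hCD, hCD.symm]
      · simp [h1, h2]
  obtain ⟨ρ, h⟩ := exists_gen_rep cs (fun E => E = C ∨ E = D) Y hY
  obtain ⟨v, hv⟩ := h.exists_roots cs' hc'
  set F := Matrix.toBilin' (gram M Y)
  set Z' := {p : B' × B' // cl cs' p.1 = C ∧ cl cs' p.2 = D ∧ M' p.1 p.2 = 0}
  set Z := {p : B × B // cl cs p.1 = C ∧ cl cs p.2 = D ∧ M p.1 p.2 = 0}
  let c : Z' → MvPolynomial (B × B) ℝ := fun p => F (v p.1.1) (v p.1.2)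
  set A := (MvPolynomial.aeval (R := ℝ) c).range with hA
  have hfin : ∀ i' j', (cl cs' i' = C ∨ cl cs' i' = D) → (cl cs' j' = C ∨ cl cs' j' = D) →
      M' i' j' ≠ 0 → F (v i') (v j') ∈ A := by
    intro i' j' hi hj h0
    obtain ⟨r, hr⟩ := const_of_finite_order h.sym (hv.norm i') (hv.norm j') h0 (by
      rw [← hv.kept i' hi, ← hv.kept j' hj, ← map_mul, ← map_pow, cs'.simple_mul_simple_pow,
        map_one])
    rw [hr]; exact A.algebraMap_mem r
  have hX : ∀ i' j', cl cs' i' = C → cl cs' j' = D → F (v i') (v j') ∈ A := by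
    intro i' j' hi hj
    by_cases h0 : M' i' j' = 0
    · exact ⟨MvPolynomial.X ⟨(i', j'), hi, hj, h0⟩, by simp [c]⟩
    · exact hfin i' j' (Or.inl hi) (Or.inr hj) h0
  have hall : ∀ i' j', (cl cs' i' = C ∨ cl cs' i' = D) → (cl cs' j' = C ∨ cl cs' j' = D) →
      F (v i') (v j') ∈ A := by
    intro i' j' hi hj
    rcases hi with hi | hi <;> rcases hj with hj | hj
    · exact hfin _ _ (Or.inl hi) (Or.inl hj) (hC _ _ hi hj)
    · exact hX _ _ hi hj
    · rw [h.sym]; exact hX _ _ hj hi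
    · exact hfin _ _ (Or.inr hi) (Or.inr hj) (hD _ _ hi hj)
  set S : Set (B → MvPolynomial (B × B) ℝ) := {x | ∃ i', (cl cs' i' = C ∨ cl cs' i' = D) ∧ x = v i'}
  have hSpan := span_pair F A S (by
    rintro _ ⟨i', hi, rfl⟩ _ ⟨j', hj, rfl⟩; exact hall _ _ hi hj)
  have hmem : ∀ i, (cl cs i = C ∨ cl cs i = D) → (Pi.single i (1 : MvPolynomial (B × B) ℝ)) ∈
      Submodule.span A S := by
    intro i hi
    refine h.mem_of_stable cs' hc v hv.norm hv.kept hv.kill (N := Submodule.span A S) ?_ ?_ ?_ i hi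
    · intro i' hi'
      exact Submodule.subset_span ⟨i', hi', rfl⟩
    · intro x hx; exact Submodule.neg_mem _ hx
    · intro i' hi' x hx
      have hvi : v i' ∈ Submodule.span A S := Submodule.subset_span ⟨i', hi', rfl⟩
      exact Submodule.sub_mem _ hx
        (Submodule.smul_mem (Submodule.span A S) (⟨_, hSpan x hx _ hvi⟩ : A) hvi)
  have hZ : ∀ z : Z, ∃ f : MvPolynomial Z' ℝ, MvPolynomial.aeval (R := ℝ) c f = MvPolynomial.X z.1 := by
    rintro ⟨⟨i, j⟩, hi, hj, h0⟩
    have hh := hSpan _ (hmem i (Or.inl hi)) _ (hmem j (Or.inr hj))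
    have hij : i ≠ j := by rintro rfl; exact hCD (hi.symm.trans hj)
    dsimp only at hi hj h0
    have h00 : ¬ (M.M i j ≠ 0) := fun h => h h0
    rw [Matrix.toBilin'_single, gram, if_neg hij, if_neg h00] at hh
    simp only [hYdef, hi, hj, and_self, if_true] at hh
    exact hh
  choose f hf using hZ
  have hind : AlgebraicIndependent ℝ f := by
    apply AlgebraicIndependent.of_comp (MvPolynomial.aeval (R := ℝ) c)
    have : (⇑(MvPolynomial.aeval (R := ℝ) c) ∘ f) = MvPolynomial.X ∘ (Subtype.val : Z → B × B) := by
      funext z; exact hf z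
    rw [this]
    exact (MvPolynomial.algebraicIndependent_X (B × B) ℝ).comp _ Subtype.val_injective
  have hle := hind.lift_cardinalMk_le_trdeg
  rw [MvPolynomial.trdeg_of_isDomain] at hle
  have : Finite Z := Subtype.finite
  have : Finite Z' := Subtype.finite
  rw [← Nat.cast_card, ← Nat.cast_card] at hle
  simpa using hle

omit [Finite B'] in
lemma infinite_order {u v : B} (h0 : M u v = 0) {a : ℕ} (ha : a ≠ 0)
    (hp : (cs.simple u * cs.simple v) ^ a = 1) : False := by
  classical
  have := Fintype.ofFinite B
  obtain ⟨ρ, h⟩ := exists_gen_rep cs (R := MvPolynomial Unit ℝ) (fun _ => True)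
    (fun _ _ => MvPolynomial.X ()) (fun _ _ => rfl)
  obtain ⟨r, hr⟩ := const_of_finite_order h.sym (h.norm u) (h.norm v) ha (by
      rw [← h.kept u trivial, ← h.kept v trivial, ← map_mul, ← map_pow, hp, map_one])
  have huv : u ≠ v := by rintro rfl; simp at h0
  have h00 : ¬ (M.M u v ≠ 0) := fun h => h h0
  rw [Matrix.toBilin'_single, gram, if_neg huv, if_neg h00] at hr
  have := congrArg MvPolynomial.totalDegree hr
  simp at this

end Two
end RR

namespace RR
section Dih
variable {B B' W : Type*} [Group W] {M : CoxeterMatrix B} (cs : CoxeterSystem M W)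
  {M' : CoxeterMatrix B'} (cs' : CoxeterSystem M' W) [Finite B] [Finite B']

/-- dihedral labels -/
def IsSol (N : ℕ) (K : ConjClasses W → Prop) (a : {i // K (cl cs i)} → ZMod N) : Prop :=
  ∀ i j, (M i.1 j.1 : ZMod N) * (a i - a j) = 0

lemma sr_pow_mul {N : ℕ} (a b : ZMod N) (m : ℕ) :
    (DihedralGroup.sr a * DihedralGroup.sr b) ^ m = DihedralGroup.r ((m : ZMod N) * (b - a)) := by
  rw [DihedralGroup.sr_mul_sr]
  induction m with
  | zero => simp
  | succ m ih => rw [pow_succ, ih, DihedralGroup.r_mul_r]; congr 1; push_cast; ring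

omit [Finite B] in
lemma exists_dih (N : ℕ) (K : ConjClasses W → Prop) (a : {i // K (cl cs i)} → ZMod N)
    (ha : IsSol cs N K a) : ∃ φ : W →* DihedralGroup N,
      (∀ i (hi : K (cl cs i)), φ (cs.simple i) = DihedralGroup.sr (a ⟨i, hi⟩)) ∧
      (∀ i (hi : ¬ K (cl cs i)), φ (cs.simple i) = 1) := by
  classical
  have hl : CoxeterMatrix.IsLiftable M
      (fun i => if h : K (cl cs i) then DihedralGroup.sr (a ⟨i, h⟩) else (1 : DihedralGroup N)) := by
    intro i j
    have hev : ∀ i j (x : ZMod N), K (cl cs i) → ¬ K (cl cs j) →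
        (DihedralGroup.sr x) ^ M i j = 1 := by
      intro i j x hi hj
      have : ¬ Odd (M i j) := fun h => hj (cl_eq_of_odd cs h ▸ hi)
      rw [Nat.not_odd_iff_even] at this
      obtain ⟨k, hk⟩ := this
      rw [hk, ← two_mul, pow_mul, pow_two, DihedralGroup.sr_mul_self, one_pow]
    by_cases hi : K (cl cs i) <;> by_cases hj : K (cl cs j)
    · simp only [hi, hj, dif_pos]
      rw [sr_pow_mul]
      have := ha ⟨j, hj⟩ ⟨i, hi⟩
      simp only [M.symmetric j i] at this
      rw [this]; rfl
    · simp [hi, hj, hev]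
    · simp [hi, hj, M.symmetric i j, hev]
    · simp [hi, hj]
  refine ⟨cs.lift ⟨_, hl⟩, ?_, ?_⟩
  · intro i hi
    rw [cs.lift_apply_simple]; simp [hi]
  · intro i hi
    rw [cs.lift_apply_simple]; simp [hi]

lemma conj_sr {N : ℕ} (a : ZMod N) {g : DihedralGroup N} (h : IsConj (DihedralGroup.sr a) g) :
    ∃ b, g = DihedralGroup.sr b := by
  obtain ⟨c, hc⟩ := isConj_iff.1 h
  subst hc
  cases c with
  | r x => exact ⟨a - x + -x, by simp only [DihedralGroup.r_mul_sr, DihedralGroup.inv_r,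
      DihedralGroup.sr_mul_r]⟩
  | sr x => exact ⟨x - (a - x), by simp only [DihedralGroup.sr_mul_sr, DihedralGroup.inv_sr,
      DihedralGroup.r_mul_sr]⟩

lemma sol_le (hc' : ∀ i', ∃ i, cl cs' i' = cl cs i)
    (N : ℕ) [NeZero N] (K : ConjClasses W → Prop) :
    Nat.card {a // IsSol cs N K a} ≤ Nat.card {a // IsSol cs' N K a} := by
  classical
  have key : ∀ a : {a // IsSol cs N K a}, ∃ (φ : W →* DihedralGroup N) (b : {a // IsSol cs' N K a}),
      (∀ i (hi : K (cl cs i)), φ (cs.simple i) = DihedralGroup.sr (a.1 ⟨i, hi⟩)) ∧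
      (∀ i' (hi : K (cl cs' i')), φ (cs'.simple i') = DihedralGroup.sr (b.1 ⟨i', hi⟩)) ∧
      (∀ i' (hi : ¬ K (cl cs' i')), φ (cs'.simple i') = 1) := by
    rintro ⟨a, ha⟩
    obtain ⟨φ, h1, h2⟩ := exists_dih cs N K a ha
    have hb : ∀ i' : {i' // K (cl cs' i')}, ∃ b, φ (cs'.simple i'.1) = DihedralGroup.sr b := by
      rintro ⟨i', hi'⟩
      obtain ⟨i, hi⟩ := hc' i'
      have hconj := φ.map_isConj ((cl_eq_iff cs cs' i i').1 hi.symm)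
      rw [h1 i (hi ▸ hi')] at hconj
      exact conj_sr _ hconj
    choose b hb using hb
    refine ⟨φ, ⟨b, ?_⟩, h1, fun i' hi => hb ⟨i', hi⟩, ?_⟩
    · intro i j
      have := congrArg φ (cs'.simple_mul_simple_pow j.1 i.1)
      rw [map_pow, map_mul, hb, hb, sr_pow_mul, map_one, DihedralGroup.one_def,
        DihedralGroup.r.injEq, M'.symmetric] at this
      exact this
    · intro i' hi'
      obtain ⟨i, hi⟩ := hc' i'
      have hconj := φ.map_isConj ((cl_eq_iff cs cs' i i').1 hi.symm)
      rw [h2 i (hi ▸ hi')] at hconj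
      exact (by simpa using hconj : 1 = φ (cs'.simple i')).symm
  choose φ b h1 h2 h3 using key
  refine Nat.card_le_card_of_injective b ?_
  intro x y hxy
  have hφ : φ x = φ y := by
    apply cs'.ext_simple
    intro i'
    by_cases hi : K (cl cs' i')
    · rw [h2 x i' hi, h2 y i' hi, hxy]
    · rw [h3 x i' hi, h3 y i' hi]
  ext i
  have e1 := h1 x i.1 i.2
  have e2 := h1 y i.1 i.2
  rw [hφ, e2] at e1
  exact (DihedralGroup.sr.inj e1).symm

end Dih
end RR

namespace RR
section ClaimB

/-- Special Gram matrix. -/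
noncomputable def gB {R : Type*} [CommRing R] (κ X : R) : Matrix (Fin 4) (Fin 4) R :=
  !![2, κ, 0, -X; κ, 2, -X, 0; 0, -X, 2, 0; -X, 0, 0, 2]

lemma gB_apply {R : Type*} [CommRing R] (κ X : R) (x y : Fin 4 → R) :
    Matrix.toBilin' (gB κ X) x y = 2 * (x 0 * y 0 + x 1 * y 1 + x 2 * y 2 + x 3 * y 3)
      + κ * (x 0 * y 1 + x 1 * y 0) - X * (x 0 * y 3 + x 3 * y 0 + x 1 * y 2 + x 2 * y 1) := by
  simp [Matrix.toBilin'_apply, Fin.sum_univ_four, gB]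
  ring

lemma real_contra (κ : ℝ) (h1 : -2 ≤ κ) (h2 : κ ≤ 2) (b c d : Fin 4 → ℝ) (g : (Fin 4 → ℝ) → (Fin 4 → ℝ) → ℝ)
    (hg : ∀ x y, g x y = 2 * (x 0 * y 0 + x 1 * y 1 + x 2 * y 2 + x 3 * y 3)
      + κ * (x 0 * y 1 + x 1 * y 0) - 10 * (x 0 * y 3 + x 3 * y 0 + x 1 * y 2 + x 2 * y 1))
    (hbb : g b b = 2) (hcc : g c c = 2) (hdd : g d d = 2) (hbc : g b c = 0) (hbd : g b d = 0)
    (hcd : g c d = 0) : False := by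
  let A : Matrix (Fin 2) (Fin 3) ℝ := !![b 0 - b 3, c 0 - c 3, d 0 - d 3;
    b 1 - b 2, c 1 - c 2, d 1 - d 2]
  have hk : LinearMap.ker A.mulVecLin ≠ ⊥ := LinearMap.ker_ne_bot_of_finrank_lt (by simp)
  obtain ⟨l, hl, hl0⟩ := (Submodule.ne_bot_iff _).1 hk
  rw [LinearMap.mem_ker, Matrix.mulVecLin_apply] at hl
  have e0 := congrFun hl 0
  have e1 := congrFun hl 1
  simp [A, Matrix.mulVec, dotProduct, Fin.sum_univ_three] at e0 e1
  have hpos : 0 < l 0 ^ 2 + l 1 ^ 2 + l 2 ^ 2 := by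
    by_contra hn
    apply hl0
    have : l 0 = 0 ∧ l 1 = 0 ∧ l 2 = 0 := by
      refine ⟨?_, ?_, ?_⟩ <;> nlinarith [sq_nonneg (l 0), sq_nonneg (l 1), sq_nonneg (l 2)]
    funext i; fin_cases i <;> simp [this]
  set x := l 0 * b 0 + l 1 * c 0 + l 2 * d 0 with hx
  set y := l 0 * b 1 + l 1 * c 1 + l 2 * d 1 with hy
  have hx3 : l 0 * b 3 + l 1 * c 3 + l 2 * d 3 = x := by rw [hx]; linarith
  have hy2 : l 0 * b 2 + l 1 * c 2 + l 2 * d 2 = y := by rw [hy]; linarith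
  have hq : 2 * (l 0 ^ 2 + l 1 ^ 2 + l 2 ^ 2) = 4 * (x^2+y^2) + 2 * κ * x * y - 20 * (x^2+y^2) := by
    have h3 : 2 * (l 0 ^ 2 + l 1 ^ 2 + l 2 ^ 2) =
      g (fun i => l 0 * b i + l 1 * c i + l 2 * d i) (fun i => l 0 * b i + l 1 * c i + l 2 * d i) := by
      have : g (fun i => l 0 * b i + l 1 * c i + l 2 * d i) (fun i => l 0 * b i + l 1 * c i + l 2 * d i)
        = l 0 ^ 2 * g b b + l 1 ^ 2 * g c c + l 2 ^ 2 * g d d + 2 * l 0 * l 1 * g b c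
          + 2 * l 0 * l 2 * g b d + 2 * l 1 * l 2 * g c d := by
        simp only [hg]; ring
      rw [this, hbb, hcc, hdd, hbc, hbd, hcd]; ring
    rw [h3, hg]
    simp only [hx3, hy2, ← hx, ← hy]; ring
  nlinarith [sq_nonneg (x - y), sq_nonneg (x + y), mul_nonneg (by linarith : 0 ≤ 2 - κ) (sq_nonneg (x+y)),
    mul_nonneg (by linarith : 0 ≤ 2 + κ) (sq_nonneg (x-y)),
    mul_nonneg (by linarith : 0 ≤ 2 - κ) (sq_nonneg (x-y)),
    mul_nonneg (by linarith : 0 ≤ 2 + κ) (sq_nonneg (x+y))]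

variable {B W : Type*} [Group W] {M : CoxeterMatrix B} (cs : CoxeterSystem M W)

lemma claimB {s t d e : B} (hst : s ≠ t) (hodd : Odd (M s t))
    (hC : ∀ i, cl cs i = cl cs s ↔ i = s ∨ i = t)
    (hDC : cl cs d ≠ cl cs s) (hEC : cl cs e ≠ cl cs s) (hDE : cl cs d ≠ cl cs e)
    (h1 : ∀ u, cl cs u = cl cs d → M t u = 0) (h2 : ∀ u, cl cs u = cl cs e → M s u = 0)
    {r p q : W} (hr : ConjClasses.mk r = cl cs s) (hp : ConjClasses.mk p = cl cs d)
    (hq : ConjClasses.mk q = cl cs e) {a b c : ℕ} (ha : a ≠ 0) (hb : b ≠ 0) (hc : c ≠ 0)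
    (ha1 : (r * p) ^ a = 1) (hb1 : (r * q) ^ b = 1) (hc1 : (p * q) ^ c = 1) : False := by
  classical
  set κ0 : ℝ := -2 * Real.cos (Real.pi / M s t) with hκ0
  set F : LinearMap.BilinForm (MvPolynomial Unit ℝ) (Fin 4 → MvPolynomial Unit ℝ) :=
    Matrix.toBilin' (gB (MvPolynomial.C κ0) (MvPolynomial.X ())) with hFdef
  have hF : ∀ x y, F x y = F y x := by
    intro x y; rw [hFdef, gB_apply, gB_apply]; ring
  let k : B → Fin 4 := fun i => if i = s then 0 else if i = t then 1 else if cl cs i = cl cs d then 2 else 3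
  let α : B → Fin 4 → MvPolynomial Unit ℝ := fun i => Pi.single (k i) 1
  have hcls : cl cs t = cl cs s := (hC t).2 (Or.inr rfl)
  have ks : k s = 0 := by simp [k]
  have kt : k t = 1 := by simp [k, hst.symm]
  have kd : ∀ u, cl cs u = cl cs d → k u = 2 := by
    intro u hu
    have n1 : u ≠ s := by rintro rfl; exact hDC hu.symm
    have n2 : u ≠ t := by rintro rfl; exact hDC (hu.symm.trans hcls)
    simp [k, n1, n2, hu]
  have ke : ∀ u, cl cs u = cl cs e → k u = 3 := by
    intro u hu
    have n1 : u ≠ s := by rintro rfl; exact hEC hu.symm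
    have n2 : u ≠ t := by rintro rfl; exact hEC (hu.symm.trans hcls)
    simp [k, n1, n2, hu, hDE.symm]
  have hnorm : ∀ i, F (α i) (α i) = 2 := by
    intro i
    simp only [hFdef, α]
    rw [Matrix.toBilin'_single]
    generalize k i = j
    fin_cases j <;> simp [gB]
  set K : ConjClasses W → Prop := fun E => E = cl cs s ∨ E = cl cs d ∨ E = cl cs e with hK
  have hcase : ∀ i, K (cl cs i) → i = s ∨ i = t ∨ cl cs i = cl cs d ∨ cl cs i = cl cs e := by
    intro i hi
    rcases hi with hi | hi | hi
    · rcases (hC i).1 hi with h | h <;> simp [h]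
    · simp [hi]
    · simp [hi]
  have hzero : ∀ i j, cl cs i ≠ cl cs j → F (α i) (α j) = 0 →
      (refl F (α i) * refl F (α j)) ^ M i j = 1 := by
    intro i j hij h0
    apply refl_pow_zero hF (hnorm i) (hnorm j) h0
    rw [← Nat.not_odd_iff_even]
    exact fun h => hij (cl_eq_of_odd cs h)
  have hG : ∀ i j, F (α i) (α j) = gB (MvPolynomial.C κ0) (MvPolynomial.X ()) (k i) (k j) := by
    intro i j
    simp only [hFdef, α]
    rw [Matrix.toBilin'_single]
  have hrr : ∀ i j, k i = k j → (refl F (α i) * refl F (α j)) ^ M i j = 1 := by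
    intro i j hij
    have : α i = α j := by simp only [α, hij]
    rw [this, refl_mul_self (hnorm j), one_pow]
  have hge : 2 ≤ M s t := by
    have := M.off_diagonal s t hst
    have h0 : M s t ≠ 0 := by intro h; rw [h] at hodd; simp at hodd
    omega
  obtain ⟨ρ, h⟩ := exists_rep cs (F := F) K α hF hnorm (by
    intro i j hi0 hj0 hij h0
    rcases hcase i hi0 with rfl | rfl | hi | hi <;> rcases hcase j hj0 with rfl | rfl | hj | hj
    · exact hrr _ _ rfl
    · exact refl_pow_cos hF (hnorm _) (hnorm _) hge (by rw [hG, ks, kt]; simp [gB, hκ0])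
    · exact hzero _ _ (by rw [hj]; exact hDC.symm) (by rw [hG, ks, kd _ hj]; simp [gB])
    · exact absurd (h2 _ hj) h0
    · rw [M.symmetric]
      exact refl_pow_cos hF (hnorm _) (hnorm _) hge (by rw [hG, ks, kt]; simp [gB, hκ0])
    · exact hrr _ _ rfl
    · exact absurd (h1 _ hj) h0
    · exact hzero _ _ (by rw [hj, hcls]; exact hEC.symm) (by rw [hG, kt, ke _ hj]; simp [gB])
    · exact hzero _ _ (by rw [hi]; exact hDC) (by rw [hG, ks, kd _ hi]; simp [gB])
    · rw [M.symmetric] at h0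
      exact absurd (h1 _ hi) h0
    · exact hrr _ _ ((kd _ hi).trans (kd _ hj).symm)
    · exact hzero _ _ (by rw [hi, hj]; exact hDE) (by rw [hG, kd _ hi, ke _ hj]; simp [gB])
    · rw [M.symmetric] at h0
      exact absurd (h2 _ hi) h0
    · exact hzero _ _ (by rw [hi, hcls]; exact hEC) (by rw [hG, kt, ke _ hi]; simp [gB])
    · exact hzero _ _ (by rw [hi, hj]; exact hDE.symm) (by rw [hG, kd _ hj, ke _ hi]; simp [gB])
    · exact hrr _ _ ((ke _ hi).trans (ke _ hj).symm))
  let ev : ℝ → MvPolynomial Unit ℝ →+* ℝ := fun z => MvPolynomial.eval (fun _ => z)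
  have evC : ∀ z x, ev z (MvPolynomial.C x) = x := by intro z x; simp [ev]
  have ev2 : ∀ z, ev z 2 = 2 := by intro z; exact map_ofNat _ 2
  have evX : ∀ z, ev z (MvPolynomial.X ()) = z := by intro z; simp [ev]
  obtain ⟨w1, hw1, hn1⟩ := h.root hr (Or.inl rfl)
  obtain ⟨w2, hw2, hn2⟩ := h.root hp (Or.inr (Or.inl rfl))
  obtain ⟨w3, hw3, hn3⟩ := h.root hq (Or.inr (Or.inr rfl))
  have hst1 : ρ w1 (α s) ∈ {x : Fin 4 → MvPolynomial Unit ℝ | ev 0 (x 2) = 0 ∧ ev 0 (x 3) = 0} := by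
    apply h.stable
    · rintro i hi0 x ⟨hx2, hx3⟩
      rw [refl_apply, hFdef, gB_apply]
      rcases hcase i hi0 with rfl | rfl | hi | hi
      · simp [α, ks, hx2, hx3, evC, evX, ev2]
      · simp [α, kt, hx2, hx3, evC, evX, ev2]
      · simp [α, kd _ hi, hx2, hx3, evC, evX, ev2]
      · simp [α, ke _ hi, hx2, hx3, evC, evX, ev2]
    · simp [α, ks]
  have hst2 : ρ w2 (α d) ∈ {x : Fin 4 → MvPolynomial Unit ℝ | ev 0 (x 0) = 0 ∧ ev 0 (x 1) = 0 ∧ ev 0 (x 3) = 0} := by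
    apply h.stable
    · rintro i hi0 x ⟨hx0, hx1, hx3⟩
      rw [refl_apply, hFdef, gB_apply]
      rcases hcase i hi0 with rfl | rfl | hi | hi
      · simp [α, ks, hx0, hx1, hx3, evC, evX, ev2]
      · simp [α, kt, hx0, hx1, hx3, evC, evX, ev2]
      · simp [α, kd _ hi, hx0, hx1, hx3, evC, evX, ev2]
      · simp [α, ke _ hi, hx0, hx1, hx3, evC, evX, ev2]
    · simp [α, kd]
  have hst3 : ρ w3 (α e) ∈ {x : Fin 4 → MvPolynomial Unit ℝ | ev 0 (x 0) = 0 ∧ ev 0 (x 1) = 0 ∧ ev 0 (x 2) = 0} := by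
    apply h.stable
    · rintro i hi0 x ⟨hx0, hx1, hx2⟩
      rw [refl_apply, hFdef, gB_apply]
      rcases hcase i hi0 with rfl | rfl | hi | hi
      · simp [α, ks, hx0, hx1, hx2, evC, evX, ev2]
      · simp [α, kt, hx0, hx1, hx2, evC, evX, ev2]
      · simp [α, kd _ hi, hx0, hx1, hx2, evC, evX, ev2]
      · simp [α, ke _ hi, hx0, hx1, hx2, evC, evX, ev2]
    · simp [α, ke]
  obtain ⟨c1, hc1'⟩ := const_of_finite_order hF hn1 hn2 ha (by
    rw [← hw1, ← hw2, ← map_mul, ← map_pow, ha1, map_one])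
  obtain ⟨c2, hc2'⟩ := const_of_finite_order hF hn1 hn3 hb (by
    rw [← hw1, ← hw3, ← map_mul, ← map_pow, hb1, map_one])
  obtain ⟨c3, hc3'⟩ := const_of_finite_order hF hn2 hn3 hc (by
    rw [← hw2, ← hw3, ← map_mul, ← map_pow, hc1, map_one])
  generalize ρ w1 (α s) = β at *
  generalize ρ w2 (α d) = γ at *
  generalize ρ w3 (α e) = δ at *
  obtain ⟨b2, b3⟩ := hst1
  obtain ⟨g0, g1, g3⟩ := hst2
  obtain ⟨d0, d1, d2⟩ := hst3
  rw [hFdef, gB_apply] at hn1 hn2 hn3 hc1' hc2' hc3'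
  have z1 : c1 = 0 := by
    have := congrArg (ev 0) hc1'
    simpa [evC, evX, ev2, b2, b3, g0, g1, g3] using this.symm
  have z2 : c2 = 0 := by
    have := congrArg (ev 0) hc2'
    simpa [evC, evX, ev2, b2, b3, d0, d1, d2] using this.symm
  have z3 : c3 = 0 := by
    have := congrArg (ev 0) hc3'
    simpa [evC, evX, ev2, g0, g1, g3, d0, d1, d2] using this.symm
  subst z1 z2 z3
  refine real_contra κ0 ?_ ?_ (fun i => ev 10 (β i)) (fun i => ev 10 (γ i)) (fun i => ev 10 (δ i))
    _ (fun x y => rfl) ?_ ?_ ?_ ?_ ?_ ?_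
  · have := Real.cos_le_one (Real.pi / M s t); rw [hκ0]; linarith
  · have := Real.neg_one_le_cos (Real.pi / M s t); rw [hκ0]; linarith
  · simpa [evC, evX, ev2] using congrArg (ev 10) hn1
  · simpa [evC, evX, ev2] using congrArg (ev 10) hn2
  · simpa [evC, evX, ev2] using congrArg (ev 10) hn3
  · simpa [evC, evX, ev2] using congrArg (ev 10) hc1'
  · simpa [evC, evX, ev2] using congrArg (ev 10) hc2'
  · simpa [evC, evX, ev2] using congrArg (ev 10) hc3'

end ClaimB
end RR

namespace RR
section Sph
variable {B W : Type*} [Group W] {M : CoxeterMatrix B} (cs : CoxeterSystem M W)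

lemma spherical_pair {i u : B} (h0 : M i u ≠ 0) : cs.IsSpherical {i, u} := by
  have hi := cs.simple_mul_simple_self i
  have hu := cs.simple_mul_simple_self u
  have hp := cs.simple_mul_simple_pow i u
  rw [CoxeterSystem.IsSpherical, CoxeterSystem.parabolic]
  set a := cs.simple i * cs.simple u with ha
  have hfin : ((Subgroup.zpowers a : Subgroup W) : Set W).Finite := by
    rw [finite_zpowers, isOfFinOrder_iff_pow_eq_one]
    exact ⟨_, Nat.pos_of_ne_zero h0, hp⟩
  have hau : cs.simple u = a⁻¹ * cs.simple i := by
    rw [ha, mul_inv_rev, cs.inv_simple, cs.inv_simple, mul_assoc, hi, mul_one]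
  refine (hfin.union (hfin.image (fun x => x * cs.simple i))).subset ?_
  have step : ∀ x, (x ∈ ((Subgroup.zpowers a : Subgroup W) : Set W) ∪
      (fun x => x * cs.simple i) '' ((Subgroup.zpowers a : Subgroup W) : Set W)) →
      ∀ y ∈ cs.simple '' {i, u}, x * y ∈ ((Subgroup.zpowers a : Subgroup W) : Set W) ∪
      (fun x => x * cs.simple i) '' ((Subgroup.zpowers a : Subgroup W) : Set W) := by
    rintro x hx y ⟨k, hk, rfl⟩
    have hamem : a ∈ Subgroup.zpowers a := Subgroup.mem_zpowers a
    rcases hk with rfl | hk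
    · rcases hx with hx | ⟨z, hz, rfl⟩
      · right; exact ⟨x, hx, rfl⟩
      · left; simpa [mul_assoc, hi] using hz
    · rw [Set.mem_singleton_iff] at hk; subst hk
      rcases hx with hx | ⟨z, hz, rfl⟩
      · right
        refine ⟨x * a⁻¹, Subgroup.mul_mem _ hx (Subgroup.inv_mem _ hamem), ?_⟩
        simp only [hau, mul_assoc]
      · left
        simp only [mul_assoc]
        exact Subgroup.mul_mem _ hz hamem
  intro x hx
  induction hx using Subgroup.closure_induction_right with
  | one => left; exact Subgroup.one_mem _
  | mul_right x hx y hy ih => exact step x ih y hy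
  | mul_inv_cancel x hx y hy ih =>
    have : y⁻¹ = y := by obtain ⟨k, _, rfl⟩ := hy; exact cs.inv_simple k
    rw [this]; exact step x ih y hy

variable [Finite B]

lemma exists_max {T : Set B} (hT : cs.IsSpherical T) : ∃ U, T ⊆ U ∧ cs.IsMaxSpherical U := by
  obtain ⟨U, h1, h2⟩ := (Set.toFinite {T | cs.IsSpherical T}).exists_le_maximal hT
  exact ⟨U, h1, h2.1, fun V hV hUV => le_antisymm (h2.2 hV hUV) hUV⟩

lemma nonzero_of_spherical {T : Set B} (hT : cs.IsSpherical T) {u v : B} (hu : u ∈ T) (hv : v ∈ T) :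
    M u v ≠ 0 := by
  intro h0
  have h1 : cs.simple u * cs.simple v ∈ cs.parabolic T :=
    Subgroup.mul_mem _ (Subgroup.subset_closure ⟨u, hu, rfl⟩) (Subgroup.subset_closure ⟨v, hv, rfl⟩)
  have hf : ((Subgroup.zpowers (cs.simple u * cs.simple v) : Subgroup W) : Set W).Finite :=
    Set.Finite.subset hT (by
      have : Subgroup.zpowers (cs.simple u * cs.simple v) ≤ cs.parabolic T := by
        rw [Subgroup.zpowers_le]; exact h1
      exact this)
  rw [finite_zpowers, isOfFinOrder_iff_pow_eq_one] at hf
  obtain ⟨n, hn, hn'⟩ := hf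
  exact infinite_order cs h0 hn.ne' hn'

/-- Combinatorial hypotheses used. -/
structure Good : Prop where
  odd : ∀ i j, i ≠ j → cl cs i = cl cs j → Odd (M i j)
  two : ∀ i j k, cl cs i = cl cs j → cl cs i = cl cs k → i = j ∨ i = k ∨ j = k
  att : ∀ i j u v, cl cs i = cl cs j → cl cs u ≠ cl cs i → cl cs v ≠ cl cs i →
    M i u ≠ 0 → M j v ≠ 0 → i = j

lemma good_of (h1 : ∀ i j : B, i ≠ j → Odd (M i j) → cs.IsMaxSpherical {i, j})
    (h2 : ¬ ∃ i j k : B, i ≠ j ∧ j ≠ k ∧ i ≠ k ∧ Odd (M i j) ∧ Odd (M j k))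
    (h3 : ∀ i j : B, i ≠ j → Odd (M i j) →
      {T : Set B | cs.IsMaxSpherical T ∧ (T ∩ {i, j}).Nonempty}.ncard ≤ 2) :
    Good cs ∧ ∀ i j u v, i ≠ j → cl cs i = cl cs j → cl cs u ≠ cl cs i → cl cs v ≠ cl cs i →
      M i u ≠ 0 → M i v ≠ 0 → M u v ≠ 0 := by
  have hodd : ∀ i j, i ≠ j → cl cs i = cl cs j → Odd (M i j) := by
    intro i j hij hcl
    obtain ⟨k, hk, hok⟩ := exists_odd cs hij hcl
    have : j = i ∨ j = k := by
      refine parity cs (P := fun a => a = i ∨ a = k) ?_ (Or.inl rfl) hcl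
      rintro a b (rfl | rfl) hab
      · by_contra hb
        push Not at hb
        exact h2 ⟨k, a, b, hk, hb.1.symm, hb.2.symm, by rwa [M.symmetric], hab⟩
      · by_contra hb
        push Not at hb
        exact h2 ⟨i, a, b, hk.symm, hb.2.symm, hb.1.symm, hok, hab⟩
    rcases this with h | h
    · exact absurd h.symm hij
    · rwa [h]
  -- a maximal spherical set for an attached element
  have hmax : ∀ i j u, i ≠ j → cl cs i = cl cs j → cl cs u ≠ cl cs i → M i u ≠ 0 →
      ∃ T, cs.IsMaxSpherical T ∧ i ∈ T ∧ u ∈ T ∧ j ∉ T ∧ T ≠ {i, j} := by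
    intro i j u hij hcl hu h0
    obtain ⟨T, hT, hm⟩ := exists_max cs (spherical_pair cs h0)
    have hiT : i ∈ T := hT (by simp)
    have huT : u ∈ T := hT (by simp)
    have hne : T ≠ {i, j} := by
      rintro rfl
      rcases huT with rfl | h
      · exact hu rfl
      · rw [Set.mem_singleton_iff] at h; subst h; exact hu hcl.symm
    refine ⟨T, hm, hiT, huT, ?_, hne⟩
    intro hj
    refine hne ((h1 i j hij (hodd i j hij hcl)).2 T hm.1 ?_)
    rintro x (rfl | hx)
    · exact hiT
    · rw [Set.mem_singleton_iff] at hx; rwa [hx]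
  have hthree : ∀ i j, i ≠ j → cl cs i = cl cs j → ∀ T1 T2, cs.IsMaxSpherical T1 →
      cs.IsMaxSpherical T2 → (T1 ∩ {i, j}).Nonempty → (T2 ∩ {i, j}).Nonempty →
      T1 ≠ {i, j} → T2 ≠ {i, j} → T1 = T2 := by
    intro i j hij hcl T1 T2 m1 m2 n1 n2 e1 e2
    by_contra hne
    have := h3 i j hij (hodd i j hij hcl)
    rw [← not_lt] at this
    apply this
    rw [Set.two_lt_ncard_iff]
    exact ⟨T1, T2, {i, j}, ⟨m1, n1⟩, ⟨m2, n2⟩, ⟨h1 i j hij (hodd i j hij hcl), ⟨i, by simp⟩⟩,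
      hne, e1, e2⟩
  refine ⟨⟨hodd, ?_, ?_⟩, ?_⟩
  · intro i j k hij hik
    by_contra hc
    push Not at hc
    exact h2 ⟨j, i, k, hc.1.symm, hc.2.1, hc.2.2, hodd j i hc.1.symm hij.symm, hodd i k hc.2.1 hik⟩
  · intro i j u v hcl hu hv h0 h0'
    by_contra hij
    obtain ⟨T1, m1, a1, _, b1, e1⟩ := hmax i j u hij hcl hu h0
    obtain ⟨T2, m2, a2, _, b2, e2⟩ := hmax j i v (Ne.symm hij) hcl.symm (hcl ▸ hv) h0'
    have := hthree i j hij hcl T1 T2 m1 m2 ⟨i, a1, by simp⟩ ⟨j, a2, by simp⟩ e1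
      (by rwa [Set.pair_comm])
    subst this
    exact b1 a2
  · intro i j u v hij hcl hu hv h0 h0'
    obtain ⟨T1, m1, a1, c1, b1, e1⟩ := hmax i j u hij hcl hu h0
    obtain ⟨T2, m2, a2, c2, b2, e2⟩ := hmax i j v hij hcl hv h0'
    have := hthree i j hij hcl T1 T2 m1 m2 ⟨i, a1, by simp⟩ ⟨i, a2, by simp⟩ e1 e2
    subst this
    exact nonzero_of_spherical cs m1.1 c1 c2

end Sph
end RR

namespace RR
section Fin
variable {B B' W : Type*} [Group W] {M : CoxeterMatrix B} {cs : CoxeterSystem M W}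
  {M' : CoxeterMatrix B'} {cs' : CoxeterSystem M' W} [Finite B] [Finite B']

omit [Finite B] in
lemma Good.ne_zero (hG : Good cs) {i j : B} (h : cl cs i = cl cs j) : M i j ≠ 0 := by
  by_cases hij : i = j
  · subst hij; simp
  · intro h0
    have := hG.odd i j hij h
    rw [h0] at this; simp at this

/-- attached -/
def att (cs : CoxeterSystem M W) (i : B) : Prop := ∃ u, cl cs u ≠ cl cs i ∧ M i u ≠ 0

lemma size_eq (hc : ∀ i, ∃ i', cl cs i = cl cs' i') (hc' : ∀ i', ∃ i, cl cs' i' = cl cs i)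
    (C : ConjClasses W) : {i | cl cs i = C}.ncard = {i' | cl cs' i' = C}.ncard :=
  le_antisymm (size_le cs cs' hc hc' C) (size_le cs' cs hc' hc C)

/-- odd and two -/
lemma odd_two (hc : ∀ i, ∃ i', cl cs i = cl cs' i') (hc' : ∀ i', ∃ i, cl cs' i' = cl cs i)
    (hG : Good cs) :
    (∀ i j, i ≠ j → cl cs' i = cl cs' j → Odd (M' i j)) ∧
    (∀ i j k, cl cs' i = cl cs' j → cl cs' i = cl cs' k → i = j ∨ i = k ∨ j = k) := by
  have htwo : ∀ i j k, cl cs' i = cl cs' j → cl cs' i = cl cs' k → i = j ∨ i = k ∨ j = k := by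
    intro i j k hij hik
    by_contra hcon
    push Not at hcon
    have h2 : 2 < {i' | cl cs' i' = cl cs' i}.ncard := by
      rw [Set.two_lt_ncard_iff]
      exact ⟨i, j, k, rfl, hij.symm, hik.symm, hcon.1, hcon.2.1, hcon.2.2⟩
    rw [← size_eq hc hc', Set.two_lt_ncard_iff] at h2
    obtain ⟨a, b, c, ha, hb, hcc, h1, h2, h3⟩ := h2
    simp only [Set.mem_setOf_eq] at ha hb hcc
    rcases hG.two a b c (ha.trans hb.symm) (ha.trans hcc.symm) with h | h | h
    · exact h1 h
    · exact h2 h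
    · exact h3 h
  refine ⟨?_, htwo⟩
  intro i j hij hcl
  obtain ⟨k, hk, hok⟩ := exists_odd cs' hij hcl
  rcases htwo i j k hcl (cl_eq_of_odd cs' hok) with h | h | h
  · exact absurd h hij
  · exact absurd h.symm hk
  · rwa [h]

/-- number of finite labels between two classes -/
lemma nz_eq (hc : ∀ i, ∃ i', cl cs i = cl cs' i') (hc' : ∀ i', ∃ i, cl cs' i' = cl cs i)
    (h1 : ∀ i j, cl cs i = cl cs j → M i j ≠ 0) (h2 : ∀ i j, cl cs' i = cl cs' j → M' i j ≠ 0)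
    {C D : ConjClasses W} (hCD : C ≠ D) :
    {p : B × B | cl cs p.1 = C ∧ cl cs p.2 = D ∧ M p.1 p.2 ≠ 0}.ncard =
    {p : B' × B' | cl cs' p.1 = C ∧ cl cs' p.2 = D ∧ M' p.1 p.2 ≠ 0}.ncard := by
  have hz : {p : B × B | cl cs p.1 = C ∧ cl cs p.2 = D ∧ M p.1 p.2 = 0}.ncard =
    {p : B' × B' | cl cs' p.1 = C ∧ cl cs' p.2 = D ∧ M' p.1 p.2 = 0}.ncard :=
    le_antisymm
      (cross_le cs cs' hc hc' hCD (fun i j hi hj => h2 i j (hi.trans hj.symm))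
        (fun i j hi hj => h2 i j (hi.trans hj.symm)))
      (cross_le cs' cs hc' hc hCD (fun i j hi hj => h1 i j (hi.trans hj.symm))
        (fun i j hi hj => h1 i j (hi.trans hj.symm)))
  have split : ∀ {β : Type _} [Finite β] (P : CoxeterMatrix β) (f : β → ConjClasses W),
      {p : β × β | f p.1 = C ∧ f p.2 = D ∧ P p.1 p.2 = 0}.ncard +
      {p : β × β | f p.1 = C ∧ f p.2 = D ∧ P p.1 p.2 ≠ 0}.ncard =
      {i | f i = C}.ncard * {i | f i = D}.ncard := by
    intro β _ P f
    rw [← Set.ncard_prod, ← Set.ncard_inter_add_ncard_diff_eq_ncard ({i | f i = C} ×ˢ {i | f i = D})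
      {p | P p.1 p.2 = 0}]
    congr 2
    · ext p; simp [and_assoc]
    · ext p; simp [and_assoc]
  have split' : ∀ {β : Type _} [Finite β] (P : CoxeterMatrix β) (f : β → ConjClasses W),
      {p : β × β | f p.1 = C ∧ f p.2 = D ∧ P p.1 p.2 = 0}.ncard +
      {p : β × β | f p.1 = C ∧ f p.2 = D ∧ P p.1 p.2 ≠ 0}.ncard =
      {i | f i = C}.ncard * {i | f i = D}.ncard := by
    intro β _ P f
    rw [← Set.ncard_prod, ← Set.ncard_inter_add_ncard_diff_eq_ncard ({i | f i = C} ×ˢ {i | f i = D})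
      {p | P p.1 p.2 = 0}]
    congr 2
    · ext p; simp [and_assoc]
    · ext p; simp [and_assoc]
  have e1 := split M (cl cs)
  have e2 := split' M' (cl cs')
  rw [size_eq hc hc' C, size_eq hc hc' D, ← e2] at e1
  omega

lemma exists_nz (hc : ∀ i, ∃ i', cl cs i = cl cs' i') (hc' : ∀ i', ∃ i, cl cs' i' = cl cs i)
    (h1 : ∀ i j, cl cs i = cl cs j → M i j ≠ 0) (h2 : ∀ i j, cl cs' i = cl cs' j → M' i j ≠ 0)
    {i' j' : B'} (hij : cl cs' i' ≠ cl cs' j') (h0 : M' i' j' ≠ 0) :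
    ∃ i j, cl cs i = cl cs' i' ∧ cl cs j = cl cs' j' ∧ M i j ≠ 0 := by
  have := nz_eq hc hc' h1 h2 hij
  have hne : {p : B × B | cl cs p.1 = cl cs' i' ∧ cl cs p.2 = cl cs' j' ∧ M p.1 p.2 ≠ 0}.ncard ≠ 0 := by
    rw [this]
    refine Set.ncard_ne_zero_of_mem (a := (i', j')) ⟨rfl, rfl, h0⟩
  obtain ⟨⟨i, j⟩, h⟩ := Set.nonempty_of_ncard_ne_zero hne
  exact ⟨i, j, h⟩

lemma good' (hc : ∀ i, ∃ i', cl cs i = cl cs' i') (hc' : ∀ i', ∃ i, cl cs' i' = cl cs i)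
    (hG : Good cs) (hF2 : ∀ i j u v, i ≠ j → cl cs i = cl cs j → cl cs u ≠ cl cs i →
      cl cs v ≠ cl cs i → M i u ≠ 0 → M i v ≠ 0 → M u v ≠ 0) : Good cs' := by
  obtain ⟨hodd, htwo⟩ := odd_two hc hc' hG
  refine ⟨hodd, htwo, ?_⟩
  have n1 : ∀ i j, cl cs i = cl cs j → M i j ≠ 0 := fun i j h => hG.ne_zero h
  have n2 : ∀ i j, cl cs' i = cl cs' j → M' i j ≠ 0 := by
    intro i j h
    by_cases hij : i = j
    · subst hij; simp
    · intro h0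
      have := hodd i j hij h
      rw [h0] at this; simp at this
  have huniq : ∀ i j k l, cl cs' i = cl cs' k → cl cs' j = cl cs' l → cl cs' i ≠ cl cs' j →
      M' i j ≠ 0 → M' k l ≠ 0 → i = k := by
    intro i j k l hik hjl hij h0 h0'
    have hle : {p : B' × B' | cl cs' p.1 = cl cs' i ∧ cl cs' p.2 = cl cs' j ∧ M' p.1 p.2 ≠ 0}.ncard
        ≤ 1 := by
      rw [← nz_eq hc hc' n1 n2 hij, Set.ncard_le_one_iff]
      rintro ⟨a, b⟩ ⟨c, d⟩ ⟨e1, e2, e3⟩ ⟨f1, f2, f3⟩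
      dsimp only at *
      have hac : a = c := hG.att a c b d (e1.trans f1.symm) (by rw [e1, e2]; exact hij.symm)
        (by rw [e1, f2]; exact hij.symm) e3 f3
      have hbd : b = d := hG.att b d a c (e2.trans f2.symm) (by rw [e1, e2]; exact hij)
        (by rw [e2, f1]; exact hij) (by rwa [M.symmetric]) (by rwa [M.symmetric])
      rw [hac, hbd]
    rw [Set.ncard_le_one_iff] at hle
    have := @hle (i, j) (k, l) ⟨rfl, rfl, h0⟩ ⟨hik.symm, hjl.symm, h0'⟩
    exact congrArg Prod.fst this
  intro s t d e hst hd he h0 h0'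
  by_contra hne
  by_cases hde : cl cs' d = cl cs' e
  · exact hne (huniq s d t e hst hde hd.symm h0 h0')
  obtain ⟨x, u, hx, hu, hxu⟩ := exists_nz hc hc' n1 n2 hd.symm h0
  obtain ⟨y, z, hy, hz, hyz⟩ := exists_nz hc hc' n1 n2 (hst ▸ he).symm h0'
  have hxy : x = y := hG.att x y u z (by rw [hx, hy, hst]) (by rw [hu, hx]; exact hd)
    (by rw [hz, hx]; exact he) hxu hyz
  subst hxy
  have hj : ∃ j, x ≠ j ∧ cl cs x = cl cs j := by
    have : 1 < {i | cl cs i = cl cs' s}.ncard := by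
      rw [size_eq hc hc', Set.one_lt_ncard_iff]
      exact ⟨s, t, rfl, hst.symm, hne⟩
    obtain ⟨j, hj, hjx⟩ := Set.exists_ne_of_one_lt_ncard this x
    exact ⟨j, hjx.symm, hx.trans hj.symm⟩
  obtain ⟨j, hxj, hj⟩ := hj
  have huz : M u z ≠ 0 := hF2 x j u z hxj hj (by rw [hu, hx]; exact hd) (by rw [hz, hx]; exact he)
    hxu hyz
  refine claimB cs' (s := s) (t := t) (d := d) (e := e) hne (hodd s t hne hst) ?_ hd he hde ?_ ?_
    (r := cs.simple x) (p := cs.simple u) (q := cs.simple z) hx hu hz hxu hyz huz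
    (cs.simple_mul_simple_pow _ _) (cs.simple_mul_simple_pow _ _) (cs.simple_mul_simple_pow _ _)
  · intro i
    constructor
    · intro hi
      rcases htwo s t i hst hi.symm with h | h | h
      · exact absurd h hne
      · exact Or.inl h.symm
      · exact Or.inr h.symm
    · rintro (rfl | rfl)
      · rfl
      · exact hst.symm
  · intro k hk
    by_contra hk0
    exact hne (huniq s d t k hst hk.symm hd.symm h0 hk0)
  · intro k hk
    by_contra hk0
    exact hne (huniq s k t e hst hk (by rw [hk]; exact he.symm) hk0 h0')

end Fin
end RR

namespace RR
section Fin2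
variable {B B' W : Type*} [Group W] {M : CoxeterMatrix B} {cs : CoxeterSystem M W}
  {M' : CoxeterMatrix B'} {cs' : CoxeterSystem M' W} [Finite B] [Finite B']

lemma att_exists (hc : ∀ i, ∃ i', cl cs i = cl cs' i') (hc' : ∀ i', ∃ i, cl cs' i' = cl cs i)
    (hG : Good cs) (hG' : Good cs') {i' : B'} (h : att cs' i') :
    ∃ i, cl cs i = cl cs' i' ∧ att cs i := by
  obtain ⟨u, hu, h0⟩ := h
  obtain ⟨a, b, h1, h2, h3⟩ := exists_nz hc hc' (fun _ _ => hG.ne_zero) (fun _ _ => hG'.ne_zero)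
    hu.symm h0
  exact ⟨a, h1, b, by rw [h1, h2]; exact hu, h3⟩

lemma att_card_le (hc : ∀ i, ∃ i', cl cs i = cl cs' i') (hc' : ∀ i', ∃ i, cl cs' i' = cl cs i)
    (hG : Good cs) (hG' : Good cs') (C : ConjClasses W) :
    {i' | cl cs' i' = C ∧ att cs' i'}.ncard ≤ {i | cl cs i = C ∧ att cs i}.ncard := by
  rcases Set.eq_empty_or_nonempty {i' | cl cs' i' = C ∧ att cs' i'} with h | ⟨i', h1, h2⟩
  · rw [h]; simp
  · obtain ⟨i, hi, hi'⟩ := att_exists hc hc' hG hG' h2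
    have h3 : {i' | cl cs' i' = C ∧ att cs' i'}.ncard ≤ 1 := by
      rw [Set.ncard_le_one_iff]
      rintro a b ⟨ha, u, hu, hu'⟩ ⟨hb, v, hv, hv'⟩
      exact hG'.att a b u v (ha.trans hb.symm) hu (by rw [ha, ← hb]; exact hv) hu' hv'
    have h4 : {i | cl cs i = C ∧ att cs i}.ncard ≠ 0 :=
      Set.ncard_ne_zero_of_mem (a := i) ⟨hi.trans h1, hi'⟩
    omega

lemma exists_psi (hc : ∀ i, ∃ i', cl cs i = cl cs' i') (hc' : ∀ i', ∃ i, cl cs' i' = cl cs i)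
    (hG : Good cs) (hG' : Good cs') :
    ∃ ψ : B ≃ B', (∀ i, cl cs' (ψ i) = cl cs i) ∧ ∀ i, att cs' (ψ i) ↔ att cs i := by
  classical
  have key : ∀ c : ConjClasses W × Prop,
      Nonempty ({i // (cl cs i, att cs i) = c} ≃ {i' // (cl cs' i', att cs' i') = c}) := by
    rintro ⟨C, p⟩
    have hA : {i | cl cs i = C ∧ att cs i}.ncard = {i' | cl cs' i' = C ∧ att cs' i'}.ncard :=
      le_antisymm (att_card_le hc' hc hG' hG C) (att_card_le hc hc' hG hG' C)
    have hS := size_eq hc hc' C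
    rw [← Set.ncard_inter_add_ncard_sdiff_eq_ncard {i | cl cs i = C} {i | att cs i},
      ← Set.ncard_inter_add_ncard_sdiff_eq_ncard {i | cl cs' i = C} {i | att cs' i}] at hS
    have hcard : {i | (cl cs i, att cs i) = (C, p)}.ncard =
        {i | (cl cs' i, att cs' i) = (C, p)}.ncard := by
      by_cases hp : p
      · have e1 : {i | (cl cs i, att cs i) = (C, p)} = {i | cl cs i = C ∧ att cs i} := by
          ext i; simp [hp]
        have e2 : {i | (cl cs' i, att cs' i) = (C, p)} = {i | cl cs' i = C ∧ att cs' i} := by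
          ext i; simp [hp]
        rw [e1, e2, hA]
      · have e1 : {i | (cl cs i, att cs i) = (C, p)} = {i | cl cs i = C} \ {i | att cs i} := by
          ext i; simp [hp]
        have e2 : {i | (cl cs' i, att cs' i) = (C, p)} = {i | cl cs' i = C} \ {i | att cs' i} := by
          ext i; simp [hp]
        rw [e1, e2]
        have e3 : {i | cl cs i = C} ∩ {i | att cs i} = {i | cl cs i = C ∧ att cs i} := rfl
        have e4 : {i | cl cs' i = C} ∩ {i | att cs' i} = {i | cl cs' i = C ∧ att cs' i} := rfl
        rw [e3, e4] at hS
        omega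
    exact Finite.card_eq.1 hcard
  have e := fun c => (key c).some
  have hm := Equiv.ofFiberEquiv_map (f := fun i => (cl cs i, att cs i))
    (g := fun i => (cl cs' i, att cs' i)) e
  refine ⟨Equiv.ofFiberEquiv e, fun i => congrArg Prod.fst (hm i), fun i => ?_⟩
  exact iff_of_eq (congrArg Prod.snd (hm i))

lemma nz_of_nz (hc : ∀ i, ∃ i', cl cs i = cl cs' i') (hc' : ∀ i', ∃ i, cl cs' i' = cl cs i)
    (hG : Good cs) (hG' : Good cs') (ψ : B ≃ B') (h1 : ∀ i, cl cs' (ψ i) = cl cs i)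
    (h2 : ∀ i, att cs' (ψ i) ↔ att cs i) {i j : B} (h0 : M i j ≠ 0) : M' (ψ i) (ψ j) ≠ 0 := by
  by_cases hij : cl cs i = cl cs j
  · exact hG'.ne_zero (by rw [h1, h1, hij])
  obtain ⟨a, b, ha, hb, hab⟩ := exists_nz hc' hc (fun _ _ => hG'.ne_zero) (fun _ _ => hG.ne_zero)
    hij h0
  obtain ⟨u, hu, hu'⟩ := (h2 i).2 ⟨j, Ne.symm hij, h0⟩
  obtain ⟨v, hv, hv'⟩ := (h2 j).2 ⟨i, hij, by rwa [M.symmetric]⟩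
  have e1 : ψ i = a := hG'.att _ a u b (by rw [h1, ha]) hu (by rw [hb, h1]; exact Ne.symm hij) hu' hab
  have e2 : ψ j = b := hG'.att _ b v a (by rw [h1, hb]) hv (by rw [ha, h1]; exact hij) hv'
    (by rwa [M'.symmetric])
  rw [e1, e2]; exact hab

lemma dvd_core (hc' : ∀ i', ∃ i, cl cs' i' = cl cs i)
    (ψ : B ≃ B') (h1 : ∀ i, cl cs' (ψ i) = cl cs i) {i j : B} (h0 : M i j ≠ 0)
    (K : ConjClasses W → Prop)
    (H : ∀ b, IsSol cs' (M i j) K b →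
      IsSol cs (M i j) K (fun k => b ⟨ψ k.1, by rw [h1]; exact k.2⟩))
    (a : {i // K (cl cs i)} → ZMod (M i j)) (ha : IsSol cs (M i j) K a)
    (hi : K (cl cs i)) (hj : K (cl cs j)) (haij : a ⟨j, hj⟩ - a ⟨i, hi⟩ = 1) :
    M i j ∣ M' (ψ j) (ψ i) := by
  have : NeZero (M i j) := ⟨h0⟩
  let f : {b // IsSol cs' (M i j) K b} → {a // IsSol cs (M i j) K a} := fun b => ⟨_, H b.1 b.2⟩
  have hf : Function.Injective f := by
    intro x y hxy
    ext ⟨i', hi'⟩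
    have := congrFun (congrArg Subtype.val hxy) ⟨ψ.symm i', by
      rw [← h1, ψ.apply_symm_apply]; exact hi'⟩
    simpa [f] using this
  have hb := hf.bijective_of_nat_card_le (sol_le cs cs' hc' (M i j) K)
  obtain ⟨b, hb⟩ := hb.2 ⟨a, ha⟩
  have hba : ∀ k, b.1 ⟨ψ k.1, by rw [h1]; exact k.2⟩ = a k := fun k =>
    congrFun (congrArg Subtype.val hb) k
  have := b.2 ⟨ψ j, by rw [h1]; exact hj⟩ ⟨ψ i, by rw [h1]; exact hi⟩
  rw [hba ⟨j, hj⟩, hba ⟨i, hi⟩, haij, mul_one] at this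
  exact (ZMod.natCast_eq_zero_iff _ _).1 this

lemma dvd_same (hc' : ∀ i', ∃ i, cl cs' i' = cl cs i) (hG : Good cs)
    (ψ : B ≃ B') (h1 : ∀ i, cl cs' (ψ i) = cl cs i) {i j : B} (hij : i ≠ j)
    (hcl : cl cs i = cl cs j) : M i j ∣ M' (ψ i) (ψ j) := by
  classical
  rw [M'.symmetric]
  have hall : ∀ a, IsSol cs (M i j) (fun C => C = cl cs i) a := by
    rintro a ⟨k, hk⟩ ⟨l, hl⟩
    by_cases hkl : k = l
    · subst hkl; simp
    have : M k l = M i j := by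
      rcases hG.two i j k hcl hk.symm with h | h | h
      · exact absurd h hij
      · subst h
        rcases hG.two i j l hcl hl.symm with h | h | h
        · exact absurd h hij
        · exact absurd h hkl
        · rw [h]
      · subst h
        rcases hG.two i j l hcl hl.symm with h | h | h
        · exact absurd h hij
        · rw [h, M.symmetric]
        · exact absurd h hkl
    simp [this]
  refine dvd_core hc' ψ h1 (hG.ne_zero hcl) (fun C => C = cl cs i) (fun b _ => hall _)
    (fun k => if k.1 = j then 1 else 0) (hall _) rfl hcl.symm (by simp [hij])

lemma dvd_diff (hc' : ∀ i', ∃ i, cl cs' i' = cl cs i) (hG : Good cs)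
    (ψ : B ≃ B') (h1 : ∀ i, cl cs' (ψ i) = cl cs i)
    (hsame : ∀ k l, k ≠ l → cl cs k = cl cs l → M k l = M' (ψ k) (ψ l)) {i j : B}
    (hcl : cl cs i ≠ cl cs j) (h0 : M i j ≠ 0) : M i j ∣ M' (ψ i) (ψ j) := by
  classical
  rw [M'.symmetric]
  have hcross : ∀ k l, (cl cs k = cl cs i ∨ cl cs k = cl cs j) →
      (cl cs l = cl cs i ∨ cl cs l = cl cs j) → cl cs k ≠ cl cs l → (M k l : ZMod (M i j)) = 0 := by
    have hc1 : ∀ k l, cl cs k = cl cs i → cl cs l = cl cs j → (M k l : ZMod (M i j)) = 0 := by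
      intro k l hk hl
      by_cases hkl : M k l = 0
      · rw [hkl]; simp
      have e1 : k = i := hG.att k i l j hk (by rw [hk, hl]; exact hcl.symm)
        (by rw [hk]; exact hcl.symm) hkl h0
      have e2 : l = j := hG.att l j k i hl (by rw [hk, hl]; exact hcl)
        (by rw [hl]; exact hcl) (by rwa [M.symmetric]) (by rwa [M.symmetric])
      rw [e1, e2]; simp
    intro k l hk hl hkl
    rcases hk with hk | hk <;> rcases hl with hl | hl
    · exact absurd (hk.trans hl.symm) hkl
    · exact hc1 k l hk hl
    · rw [M.symmetric k l]; exact hc1 l k hl hk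
    · exact absurd (hk.trans hl.symm) hkl
  refine dvd_core hc' ψ h1 h0 (fun C => C = cl cs i ∨ C = cl cs j) ?_
    (fun k => if cl cs k.1 = cl cs j then 1 else 0) ?_ (Or.inl rfl) (Or.inr rfl) (by simp [hcl])
  · rintro b hb ⟨k, hk⟩ ⟨l, hl⟩
    by_cases hkl : k = l
    · subst hkl; simp
    by_cases hck : cl cs k = cl cs l
    · have := hb ⟨ψ k, by rw [h1]; exact hk⟩ ⟨ψ l, by rw [h1]; exact hl⟩
      simp only at this ⊢
      rw [hsame k l hkl hck]; exact this
    · simp only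
      rw [hcross k l hk hl hck, zero_mul]
  · rintro ⟨k, hk⟩ ⟨l, hl⟩
    by_cases hck : cl cs k = cl cs l
    · simp [hck]
    · simp only
      rw [hcross k l hk hl hck, zero_mul]

lemma rigid (hc : ∀ i, ∃ i', cl cs i = cl cs' i') (hc' : ∀ i', ∃ i, cl cs' i' = cl cs i)
    (hG : Good cs) (hG' : Good cs') : ∃ ψ : B ≃ B', ∀ i j, M i j = M' (ψ i) (ψ j) := by
  obtain ⟨ψ, h1, h2⟩ := exists_psi hc hc' hG hG'
  have k1 : ∀ i', cl cs (ψ.symm i') = cl cs' i' := by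
    intro i'; rw [← h1, ψ.apply_symm_apply]
  have k2 : ∀ i', att cs (ψ.symm i') ↔ att cs' i' := by
    intro i'; rw [← h2, ψ.apply_symm_apply]
  have hsame : ∀ k l, k ≠ l → cl cs k = cl cs l → M k l = M' (ψ k) (ψ l) := by
    intro k l hkl hcl
    apply Nat.dvd_antisymm (dvd_same hc' hG ψ h1 hkl hcl)
    have := dvd_same hc hG' ψ.symm k1 (i := ψ k) (j := ψ l) (by simpa using hkl) (by rw [h1, h1, hcl])
    simpa using this
  have hsame' : ∀ k l, k ≠ l → cl cs' k = cl cs' l → M' k l = M (ψ.symm k) (ψ.symm l) := by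
    intro k l hkl hcl
    have := hsame (ψ.symm k) (ψ.symm l) (by simpa using hkl) (by rw [k1, k1, hcl])
    rw [this]; simp
  refine ⟨ψ, fun i j => ?_⟩
  by_cases hij : i = j
  · subst hij; simp
  by_cases hcl : cl cs i = cl cs j
  · exact hsame i j hij hcl
  by_cases h0 : M i j = 0
  · by_contra hne
    have := nz_of_nz hc' hc hG' hG ψ.symm k1 k2 (i := ψ i) (j := ψ j)
      (fun h => hne (h0.trans h.symm))
    simp at this
    exact this h0
  have h0' := nz_of_nz hc hc' hG hG' ψ h1 h2 h0
  apply Nat.dvd_antisymm (dvd_diff hc' hG ψ h1 hsame hcl h0)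
  have := dvd_diff hc hG' ψ.symm k1 hsame' (i := ψ i) (j := ψ j) (by rwa [h1, h1]) h0'
  simpa using this

omit [Finite B] [Finite B'] in
lemma hc_of (h : ∀ w : W, cs.IsReflection w → cs'.IsReflection w) (i : B) :
    ∃ i', cl cs i = cl cs' i' := by
  obtain ⟨w, i', hw⟩ := h _ (cs.isReflection_simple i)
  refine ⟨i', ?_⟩
  rw [cl_eq_iff]
  exact (isConj_iff.2 ⟨w, hw.symm⟩).symm

end Fin2
end RR


/-- **Theorem (Hosaka).** Let `(W, S)` be a Coxeter system such that
(1) for each `s, t ∈ S` with `m (s, t)` odd, `{s, t}` is a maximal spherical subset of `S`;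
(2) there is no three-element subset `{s, t, u} ⊆ S` with `m (s, t)` and `m (t, u)` odd; and
(3) for each `s, t ∈ S` with `m (s, t)` odd, at most two maximal spherical subsets of `S`
intersect `{s, t}`.  Then `(W, S)` is reflection rigid. -/
theorem reflection_rigid_of_odd_conditions {B W : Type*} [Group W] [Finite B]
    {M : CoxeterMatrix B} (cs : CoxeterSystem M W)
    (h1 : ∀ i j : B, i ≠ j → Odd (M i j) → cs.IsMaxSpherical {i, j})
    (h2 : ¬ ∃ i j k : B, i ≠ j ∧ j ≠ k ∧ i ≠ k ∧ Odd (M i j) ∧ Odd (M j k))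
    (h3 : ∀ i j : B, i ≠ j → Odd (M i j) →
      {T : Set B | cs.IsMaxSpherical T ∧ (T ∩ {i, j}).Nonempty}.ncard ≤ 2) :
    cs.ReflectionRigid := by
  intro B' _ M' cs' h
  have hc := RR.hc_of (cs := cs) (cs' := cs') (fun w => (h w).1)
  have hc' := RR.hc_of (cs := cs') (cs' := cs) (fun w => (h w).2)
  obtain ⟨hG, hF2⟩ := RR.good_of cs h1 h2 h3
  exact RR.rigid hc hc' hG (RR.good' hc hc' hG hF2)
end

section
/- Let (W,S) be a Coxeter system satisfying conditions (1), (2), (3) below, let (W',S') be a Coxeter system, and let φ: W → W' be a group isomorphism such that φ maps every reflection of (W,S) to a reflection of (W',S'). Then for each s',t' ∈ S' such that m'(s',t') is odd, {s',t'} is a maximal spherical subset of S'. Conditions: (1) for each s,t ∈ S with m(s,t) odd, {s,t} is a maximal spherical subset of S; (2) there is no three-element subset {s,t,u} ⊆ S with m(s,t) and m(t,u) both odd; (3) for each s,t ∈ S with m(s,t) odd, at most two maximal spherical subsets of S intersect {s,t}. -/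
namespace CoxGeo

set_option linter.unusedSectionVars false
set_option linter.unusedSimpArgs false

open Real

variable {B : Type*}

/-- Twice the entries of the canonical bilinear form. -/
noncomputable def cf (M : CoxeterMatrix B) (i j : B) : ℝ :=
  if M i j = 0 then -2 else -(2 * Real.cos (π / M i j))

theorem cf_self (M : CoxeterMatrix B) (i : B) : cf M i i = 2 := by
  simp [cf]

theorem cf_symm (M : CoxeterMatrix B) (i j : B) : cf M i j = cf M j i := by
  simp [cf, M.symmetric i j]

/-- Chebyshev-like function. -/
noncomputable def U (m : ℕ) (x : ℝ) : ℝ :=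
  if m = 0 then x else Real.sin (x * (π / m)) / Real.sin (π / m)

theorem sin_pos_of {m : ℕ} (h0 : m ≠ 0) (h1 : m ≠ 1) : 0 < Real.sin (π / m) := by
  have h2 : (2:ℝ) ≤ m := by exact_mod_cast (by omega : 2 ≤ m)
  apply Real.sin_pos_of_pos_of_lt_pi
  · positivity
  · rw [div_lt_iff₀ (by linarith)]; nlinarith [Real.pi_pos]

theorem U_rec (M : CoxeterMatrix B) (i j : B) (x : ℝ) :
    U (M i j) (x + 1) = -cf M i j * U (M i j) x - U (M i j) (x - 1) := by
  unfold U cf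
  split_ifs with h
  · ring
  · rw [add_mul, sub_mul, Real.sin_add, Real.sin_sub]; ring_nf

theorem U_zero (m : ℕ) : U m 0 = 0 := by simp [U]

theorem U_one {m : ℕ} (h1 : m ≠ 1) : U m 1 = 1 := by
  unfold U; split_ifs with h
  · rfl
  · rw [one_mul, div_self (sin_pos_of h h1).ne']

theorem U_neg_one {m : ℕ} (h1 : m ≠ 1) : U m (-1) = -1 := by
  unfold U; split_ifs with h
  · rfl
  · rw [neg_one_mul, Real.sin_neg, neg_div, div_self (sin_pos_of h h1).ne']

theorem U_nonneg {m : ℕ} (h1 : m ≠ 1) (k : ℕ) (hk : m = 0 ∨ k ≤ m) : 0 ≤ U m k := by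
  unfold U; split_ifs with h
  · positivity
  · have hk' : k ≤ m := by tauto
    have hm : (0:ℝ) < m := by exact_mod_cast (Nat.pos_of_ne_zero h)
    have : (k:ℝ) ≤ m := by exact_mod_cast hk'
    apply div_nonneg _ (sin_pos_of h h1).le
    apply Real.sin_nonneg_of_nonneg_of_le_pi
    · positivity
    · rw [mul_div_assoc', div_le_iff₀ hm]; nlinarith [Real.pi_pos]

theorem U_period {m : ℕ} (h : m ≠ 0) (x : ℝ) : U m (x + 2 * m) = U m x := by
  have hm : (m:ℝ) ≠ 0 := by exact_mod_cast h
  unfold U; rw [if_neg h, if_neg h, add_mul]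
  congr 1
  rw [show 2 * (m:ℝ) * (π / m) = 2 * π by field_simp, Real.sin_add_two_pi]

theorem dvd_of_U {m n : ℕ} (h1 : m ≠ 1) (hU : U m (2 * n) = 0) (hU1 : U m (2 * n + 1) = 1) :
    m ∣ n := by
  unfold U at hU hU1
  split_ifs at hU hU1 with h
  · have : n = 0 := by
      have : (n:ℝ) = 0 := by linarith
      exact_mod_cast this
    simp [this]
  · have hs := sin_pos_of h h1
    have hm : (m:ℝ) ≠ 0 := by exact_mod_cast h
    rw [div_eq_zero_iff, or_iff_left hs.ne'] at hU
    rw [add_mul, Real.sin_add, hU, one_mul, zero_mul, zero_add, mul_div_assoc, div_self hs.ne',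
      mul_one, Real.cos_eq_one_iff] at hU1
    obtain ⟨z, hz⟩ := hU1
    have h3 : (z * m : ℝ) = n := by
      field_simp at hz
      have := Real.pi_pos
      nlinarith
    have h4 : (z * m : ℤ) = n := by exact_mod_cast h3
    exact Int.natCast_dvd_natCast.1 ⟨z, by rw [← h4]; ring⟩

variable [Fintype B] [DecidableEq B]

/-- Simple roots. -/
noncomputable def e (i : B) : B → ℝ := Pi.single i 1

/-- Simple coroots. -/
noncomputable def cor (M : CoxeterMatrix B) (i : B) : (B → ℝ) →ₗ[ℝ] ℝ where
  toFun x := ∑ j, x j * cf M i j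
  map_add' x y := by simp [add_mul, Finset.sum_add_distrib]
  map_smul' c x := by simp [mul_assoc, Finset.mul_sum]

theorem cor_e (M : CoxeterMatrix B) (i j : B) : cor M i (e j) = cf M i j := by
  simp [cor, e, Pi.single_apply]

/-- Simple reflections. -/
noncomputable def sig (M : CoxeterMatrix B) (i : B) : (B → ℝ) →ₗ[ℝ] (B → ℝ) :=
  LinearMap.id - (cor M i).smulRight (e i)

theorem sig_apply (M : CoxeterMatrix B) (i : B) (x : B → ℝ) :
    sig M i x = x - cor M i x • e i := by
  simp [sig]

theorem sig_left (M : CoxeterMatrix B) (i j : B) (x y : ℝ) :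
    sig M i (x • e i + y • e j) = (-cf M i j * y - x) • e i + y • e j := by
  simp only [sig_apply, map_add, map_smul, cor_e, cf_self, smul_eq_mul]
  module

theorem sig_right (M : CoxeterMatrix B) (i j : B) (x y : ℝ) :
    sig M j (x • e i + y • e j) = x • e i + (-cf M i j * x - y) • e j := by
  simp only [sig_apply, map_add, map_smul, cor_e, cf_self, smul_eq_mul, cf_symm M j i]
  module

theorem sig_sig_U (M : CoxeterMatrix B) (i j : B) (x : ℝ) :
    sig M i (sig M j (U (M i j) (x + 1) • e i + U (M i j) x • e j)) =
      U (M i j) (x + 2 + 1) • e i + U (M i j) (x + 2) • e j := by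
  have h1 := U_rec M i j (x + 1)
  have h2 := U_rec M i j (x + 2)
  rw [show x + 1 + 1 = x + 2 by ring, show x + 1 - 1 = x by ring] at h1
  rw [show x + 2 - 1 = x + 1 by ring] at h2
  rw [sig_right, ← h1, sig_left, ← h2]

theorem sig_pow_U (M : CoxeterMatrix B) (i j : B) (x : ℝ) (n : ℕ) :
    ((sig M i * sig M j) ^ n) (U (M i j) (x + 1) • e i + U (M i j) x • e j) =
      U (M i j) (x + 2 * n + 1) • e i + U (M i j) (x + 2 * n) • e j := by
  induction n with
  | zero => simp
  | succ n ih =>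
    rw [pow_succ', Module.End.mul_apply, ih, Module.End.mul_apply, sig_sig_U]
    push_cast
    ring_nf

theorem sig_pow_e (M : CoxeterMatrix B) {i j : B} (hij : i ≠ j) (n : ℕ) :
    ((sig M i * sig M j) ^ n) (e i) =
      U (M i j) (2 * n + 1) • e i + U (M i j) (2 * n) • e j := by
  have := sig_pow_U M i j 0 n
  simpa [U_zero, U_one (M.off_diagonal i j hij)] using this

theorem sig_liftable (M : CoxeterMatrix B) : M.IsLiftable (sig M) := by
  intro i j
  by_cases h0 : M i j = 0
  · simp [h0]
  by_cases hij : i = j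
  · subst hij
    rw [M.diagonal, pow_one]
    ext1 k
    ext1
    simp only [LinearMap.comp_apply, Module.End.mul_apply, sig_apply, map_sub, map_smul, cor_e,
      cf_self, Module.End.one_apply, smul_eq_mul]
    module
  have h1 : M i j ≠ 1 := M.off_diagonal i j hij
  set m := M i j with hm
  have ei : ((sig M i * sig M j) ^ m) (e i) = e i := by
    have := sig_pow_U M i j 0 m
    rw [← hm, add_right_comm, U_period h0, U_period h0, zero_add, U_zero, U_one h1] at this
    simpa using this
  have ej : ((sig M i * sig M j) ^ m) (e j) = e j := by
    have := sig_pow_U M i j (-1) m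
    rw [← hm, add_right_comm, U_period h0, U_period h0, neg_add_cancel, U_zero, U_neg_one h1] at this
    simpa using this
  have fixed : ∀ y, cor M i y = 0 → cor M j y = 0 → ((sig M i * sig M j) ^ m) y = y := by
    intro y hi hj
    have : (sig M i * sig M j) y = y := by
      simp [Module.End.mul_apply, sig_apply, hi, hj]
    rw [Module.End.pow_apply]
    exact Function.iterate_fixed this m
  ext1 k
  ext1
  set z := (LinearMap.single ℝ (fun _ : B => ℝ) k) 1
  change ((sig M i * sig M j) ^ m) z = z
  set c := cf M i j with hc
  have hc4 : 4 - c ^ 2 ≠ 0 := by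
    have : 4 - c ^ 2 = 4 * Real.sin (π / m) ^ 2 := by
      rw [hc, cf, ← hm, if_neg h0, Real.sin_sq]; ring
    rw [this]
    have := sin_pos_of h0 h1
    positivity
  obtain ⟨p, q, hp, hq⟩ : ∃ p q : ℝ, 2 * p + c * q = cor M i z ∧ c * p + 2 * q = cor M j z := by
    refine ⟨(2 * cor M i z - c * cor M j z) / (4 - c ^ 2),
      (2 * cor M j z - c * cor M i z) / (4 - c ^ 2), ?_, ?_⟩ <;> field_simp <;> ring
  have hz : z = (z - (p • e i + q • e j)) + (p • e i + q • e j) := by abel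
  have := fixed (z - (p • e i + q • e j))
    (by simp only [map_sub, map_add, map_smul, cor_e, cf_self, smul_eq_mul, ← hc]; linarith)
    (by simp only [map_sub, map_add, map_smul, cor_e, cf_self, smul_eq_mul, cf_symm M j i, ← hc]
        linarith)
  rw [hz, map_add, this, map_add, map_smul, map_smul, ei, ej]

variable {W : Type*} [Group W] {M : CoxeterMatrix B} (cs : CoxeterSystem M W)

/-- Geometric representation. -/
noncomputable def rho : W →* ((B → ℝ) →ₗ[ℝ] (B → ℝ)) := cs.lift ⟨sig M, sig_liftable M⟩

theorem rho_simple (i : B) : rho cs (cs.simple i) = sig M i := by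
  simp [rho]

theorem rho_simple_apply (i : B) (x : B → ℝ) :
    rho cs (cs.simple i) x = x - cor M i x • e i := by
  rw [rho_simple, sig_apply]

theorem rho_mul (g h : W) (x : B → ℝ) : rho cs (g * h) x = rho cs g (rho cs h x) := by
  rw [map_mul, Module.End.mul_apply]

theorem rho_one (x : B → ℝ) : rho cs 1 x = x := by
  rw [map_one, Module.End.one_apply]

theorem rho_inv_self (g : W) (x : B → ℝ) : rho cs g⁻¹ (rho cs g x) = x := by
  rw [← rho_mul, inv_mul_cancel, rho_one]

theorem rho_self_inv (g : W) (x : B → ℝ) : rho cs g (rho cs g⁻¹ x) = x := by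
  rw [← rho_mul, mul_inv_cancel, rho_one]

theorem rho_inj (g : W) {x y : B → ℝ} (h : rho cs g x = rho cs g y) : x = y := by
  rw [← rho_inv_self cs g x, h, rho_inv_self]

theorem e_ne_zero (i : B) : e i ≠ 0 := by
  intro h; have := congrFun h i; simp [e] at this

theorem e_nonneg (i : B) : 0 ≤ e i := by
  intro k; by_cases h : k = i <;> simp [e, Pi.single_apply, h]

theorem alt_e {i j : B} (hij : i ≠ j) (k : ℕ) (hk : M i j = 0 ∨ k + 1 ≤ M i j) :
    ∃ p q : ℝ, 0 ≤ p ∧ 0 ≤ q ∧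
      rho cs (cs.wordProd (CoxeterSystem.alternatingWord i j k)) (e i) = p • e i + q • e j := by
  have h1 : M i j ≠ 1 := M.off_diagonal i j hij
  rw [cs.prod_alternatingWord_eq_mul_pow, rho_mul, map_pow, map_mul, rho_simple, rho_simple,
    sig_pow_e M hij]
  rcases Nat.even_or_odd' k with ⟨n, rfl | rfl⟩
  · refine ⟨U (M i j) (2 * n + 1), U (M i j) (2 * n), ?_, ?_, ?_⟩
    · exact_mod_cast U_nonneg h1 (2 * n + 1) (by omega)
    · exact_mod_cast U_nonneg h1 (2 * n) (by omega)
    · rw [if_pos (by simp), rho_one, Nat.mul_div_cancel_left _ (by norm_num)]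
  · refine ⟨U (M i j) (2 * n + 1), U (M i j) (2 * n + 1 + 1), ?_, ?_, ?_⟩
    · exact_mod_cast U_nonneg h1 (2 * n + 1) (by omega)
    · exact_mod_cast U_nonneg h1 (2 * n + 1 + 1) (by omega)
    · have h2 := U_rec M i j (2 * n + 1)
      rw [add_sub_cancel_right] at h2
      rw [if_neg (by simp), rho_simple, show (2 * n + 1) / 2 = n by omega, sig_right, ← h2]

theorem pos_of_not_desc_aux (n : ℕ) : ∀ w : W, cs.length w = n → ∀ i : B,
    ¬ cs.IsRightDescent w i → 0 ≤ rho cs w (e i) := by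
  classical
  induction n using Nat.strong_induction_on with
  | _ n IH =>
  intro w hw i hi
  by_cases hw1 : w = 1
  · subst hw1; rw [rho_one]; exact e_nonneg i
  obtain ⟨j, hj⟩ := cs.exists_rightDescent_of_ne_one hw1
  have hij : i ≠ j := by rintro rfl; exact hi hj
  let Q : ℕ → Prop := fun k => ∃ v, w = v * cs.wordProd (CoxeterSystem.alternatingWord i j k) ∧
    cs.length w = cs.length v + k
  have hQ1 : Q 1 := by
    refine ⟨w * cs.simple j, ?_, ?_⟩
    · simp [CoxeterSystem.alternatingWord]
    · exact (cs.isRightDescent_iff.1 hj).symm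
  have hQle : ∀ k, Q k → k ≤ n := by
    rintro k ⟨v, -, h⟩; omega
  have hk1 : 1 ≤ Nat.findGreatest Q n := Nat.le_findGreatest (hQle 1 hQ1) hQ1
  have hQk : Q (Nat.findGreatest Q n) := Nat.findGreatest_spec (hQle 1 hQ1) hQ1
  have hQk1 : ¬ Q (Nat.findGreatest Q n + 1) := by
    intro h
    have := Nat.le_findGreatest (hQle _ h) h
    omega
  generalize Nat.findGreatest Q n = k at hk1 hQk hQk1
  obtain ⟨v, hv, hl⟩ := hQk
  have hdesc : ∀ c, (c = if Even k then j else i) → ¬ cs.IsRightDescent v c := by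
    intro c hc hd
    apply hQk1
    refine ⟨v * cs.simple c, ?_, ?_⟩
    · rw [CoxeterSystem.alternatingWord_succ', ← hc, cs.wordProd_cons, ← mul_assoc,
        cs.simple_mul_simple_cancel_right, ← hv]
    · have := cs.isRightDescent_iff.1 hd
      omega
  have hdesc2 : ∀ c, (c = if Even (k - 1) then j else i) → ¬ cs.IsRightDescent v c := by
    intro c hc hd
    obtain ⟨k', rfl⟩ : ∃ k', k = k' + 1 := ⟨k - 1, by omega⟩
    rw [Nat.add_sub_cancel] at hc
    rw [CoxeterSystem.alternatingWord_succ', ← hc, cs.wordProd_cons, ← mul_assoc] at hv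
    have h1 := cs.length_mul_le (v * cs.simple c)
      (cs.wordProd (CoxeterSystem.alternatingWord i j k'))
    rw [← hv] at h1
    have h2 := cs.length_wordProd_le (CoxeterSystem.alternatingWord i j k')
    rw [CoxeterSystem.length_alternatingWord] at h2
    have := cs.isRightDescent_iff.1 hd
    omega
  have hvi : ¬ cs.IsRightDescent v i ∧ ¬ cs.IsRightDescent v j := by
    rcases Nat.even_or_odd k with h | h
    · have h' : ¬ Even (k - 1) := by
        rw [Nat.not_even_iff_odd]; exact Nat.Even.sub_odd hk1 h odd_one
      exact ⟨hdesc2 i (by rw [if_neg h']), hdesc j (by rw [if_pos h])⟩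
    · have h' : Even (k - 1) := Nat.Odd.sub_odd h odd_one
      exact ⟨hdesc i (by rw [if_neg (by simpa using h)]), hdesc2 j (by rw [if_pos h'])⟩
  have pi := IH (cs.length v) (by omega) v rfl i hvi.1
  have pj := IH (cs.length v) (by omega) v rfl j hvi.2
  have hkm : M i j = 0 ∨ k + 1 ≤ M i j := by
    by_contra hcon
    push Not at hcon
    obtain ⟨hm0, hkm⟩ := hcon
    rcases (by omega : M i j < k ∨ k = M i j) with h | h
    · have h1 := cs.not_isReduced_alternatingWord i j hm0 h
      unfold CoxeterSystem.IsReduced at h1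
      have h2 := cs.length_wordProd_le (CoxeterSystem.alternatingWord i j k)
      rw [CoxeterSystem.length_alternatingWord] at h1 h2
      have h3 := cs.length_mul_le v (cs.wordProd (CoxeterSystem.alternatingWord i j k))
      rw [← hv] at h3
      omega
    · apply hi
      have hb := cs.wordProd_braidWord_eq i j
      unfold CoxeterSystem.braidWord at hb
      rw [M.symmetric j i, ← h] at hb
      obtain ⟨k', rfl⟩ : ∃ k', k = k' + 1 := ⟨k - 1, by omega⟩
      rw [hb, CoxeterSystem.alternatingWord_succ, cs.wordProd_concat, ← mul_assoc] at hv
      unfold CoxeterSystem.IsRightDescent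
      have h2 := cs.length_wordProd_le (CoxeterSystem.alternatingWord i j k')
      rw [CoxeterSystem.length_alternatingWord] at h2
      have h3 := cs.length_mul_le v (cs.wordProd (CoxeterSystem.alternatingWord i j k'))
      have h4 : w * cs.simple i = v * cs.wordProd (CoxeterSystem.alternatingWord i j k') := by
        rw [hv, cs.simple_mul_simple_cancel_right]
      rw [h4]
      omega
  obtain ⟨p, q, hp, hq, hpq⟩ := alt_e cs hij k hkm
  rw [hv, rho_mul, hpq, map_add, map_smul, map_smul]
  exact add_nonneg (smul_nonneg hp pi) (smul_nonneg hq pj)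

theorem pos_of_not_desc {w : W} {i : B} (h : ¬ cs.IsRightDescent w i) : 0 ≤ rho cs w (e i) :=
  pos_of_not_desc_aux cs _ w rfl i h

theorem neg_of_desc {w : W} {i : B} (h : cs.IsRightDescent w i) : rho cs w (e i) ≤ 0 := by
  have h1 := pos_of_not_desc cs (cs.isRightDescent_iff_not_isRightDescent_mul.1 h)
  rw [rho_mul, rho_simple_apply, cor_e, cf_self, map_sub, map_smul, two_smul] at h1
  simpa using h1

theorem eq_one_of_pos {w : W} (h : ∀ i, 0 ≤ rho cs w (e i)) : w = 1 := by
  by_contra hw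
  obtain ⟨i, hi⟩ := cs.exists_rightDescent_of_ne_one hw
  have h1 := le_antisymm (neg_of_desc cs hi) (h i)
  exact e_ne_zero i (rho_inj cs w (by rw [h1, map_zero]))

end CoxGeo
namespace CoxGeo

set_option linter.unusedSimpArgs false

set_option linter.unusedSectionVars false

variable {B : Type*} [Fintype B] [DecidableEq B]
variable {W : Type*} [Group W] {M : CoxeterMatrix B} (cs : CoxeterSystem M W)

/-- The canonical quadratic form. -/
noncomputable def qf (M : CoxeterMatrix B) (x : B → ℝ) : ℝ := ∑ i, x i * cor M i x

theorem qf_smul_e (c : ℝ) (k : B) : qf M (c • e k) = c ^ 2 * 2 := by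
  unfold qf
  simp only [map_smul, cor_e, Pi.smul_apply, smul_eq_mul]
  rw [Finset.sum_eq_single k]
  · simp [e, cf_self]; ring
  · intro j _ hj; simp [e, hj]
  · simp

theorem qf_sig (k : B) (x : B → ℝ) : qf M (sig M k x) = qf M x := by
  have h1 : ∑ i, x i * cf M i k = cor M k x := by
    simp only [cor, LinearMap.coe_mk, AddHom.coe_mk]
    exact Finset.sum_congr rfl fun i _ => by rw [cf_symm]
  have h2 : ∑ i, e k i * cor M i x = cor M k x := by
    simp [e, Pi.single_apply]
  have h3 : ∑ i, e k i * cf M i k = 2 := by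
    simp [e, Pi.single_apply, cf_self]
  set c := cor M k x with hc
  have h4 : qf M (sig M k x) = qf M x - c * (∑ i, x i * cf M i k) - c * (∑ i, e k i * cor M i x)
      + c ^ 2 * ∑ i, e k i * cf M i k := by
    unfold qf
    rw [sig_apply, ← hc, Finset.mul_sum, Finset.mul_sum, Finset.mul_sum,
      ← Finset.sum_sub_distrib, ← Finset.sum_sub_distrib, ← Finset.sum_add_distrib]
    refine Finset.sum_congr rfl fun i _ => ?_
    simp only [map_sub, map_smul, cor_e, Pi.sub_apply, Pi.smul_apply, smul_eq_mul]
    ring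
  rw [h4, h1, h2, h3]; ring

theorem qf_rho (w : W) (x : B → ℝ) : qf M (rho cs w x) = qf M x := by
  induction w using cs.simple_induction_left with
  | one => rw [rho_one]
  | mul_simple_left w i ih => rw [rho_mul, rho_simple, qf_sig, ih]

/-- Roots of a standard parabolic subgroup. -/
def IsRoot (T : Set B) (α : B → ℝ) : Prop :=
  ∃ w ∈ cs.parabolic T, ∃ i ∈ T, α = rho cs w (e i)

theorem simple_mem_parabolic {T : Set B} {i : B} (hi : i ∈ T) : cs.simple i ∈ cs.parabolic T :=
  Subgroup.subset_closure ⟨i, hi, rfl⟩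

theorem mem_parabolic_univ (w : W) : w ∈ cs.parabolic Set.univ := by
  unfold CoxeterSystem.parabolic
  rw [Set.image_univ, cs.subgroup_closure_range_simple]
  trivial

variable {cs}

theorem IsRoot.to_univ {T : Set B} {α : B → ℝ} (h : IsRoot cs T α) : IsRoot cs Set.univ α := by
  obtain ⟨w, _, i, _, h⟩ := h
  exact ⟨w, mem_parabolic_univ cs w, i, trivial, h⟩

theorem isRoot_e {T : Set B} {i : B} (hi : i ∈ T) : IsRoot cs T (e i) :=
  ⟨1, one_mem _, i, hi, by rw [rho_one]⟩

theorem IsRoot.rho {T : Set B} {α : B → ℝ} (h : IsRoot cs T α) {w : W} (hw : w ∈ cs.parabolic T) :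
    IsRoot cs T (rho cs w α) := by
  obtain ⟨v, hv, i, hi, rfl⟩ := h
  exact ⟨w * v, mul_mem hw hv, i, hi, by rw [rho_mul]⟩

theorem IsRoot.pm {T : Set B} {α : B → ℝ} (h : IsRoot cs T α) : 0 ≤ α ∨ α ≤ 0 := by
  obtain ⟨v, hv, i, hi, rfl⟩ := h
  by_cases hd : cs.IsRightDescent v i
  · exact Or.inr (neg_of_desc cs hd)
  · exact Or.inl (pos_of_not_desc cs hd)

theorem IsRoot.ne_zero {T : Set B} {α : B → ℝ} (h : IsRoot cs T α) : α ≠ 0 := by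
  obtain ⟨v, hv, i, hi, rfl⟩ := h
  intro h
  exact e_ne_zero i (rho_inj cs v (by rw [h, map_zero]))

theorem IsRoot.simple_pos {T : Set B} {α : B → ℝ} (h : IsRoot cs T α) (h0 : 0 ≤ α) (k : B) :
    α = e k ∨ 0 ≤ CoxGeo.rho cs (cs.simple k) α := by
  by_cases hj : ∃ j, j ≠ k ∧ α j ≠ 0
  · obtain ⟨j, hjk, hj⟩ := hj
    right
    have hr := h.to_univ.rho (mem_parabolic_univ cs (cs.simple k))
    refine hr.pm.resolve_right fun hn => ?_
    have h1 := hn j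
    rw [rho_simple_apply] at h1
    simp only [e, Pi.sub_apply, Pi.smul_apply, Pi.single_apply, if_neg hjk, smul_eq_mul, mul_zero,
      sub_zero, Pi.zero_apply] at h1
    exact hj (le_antisymm h1 (h0 j))
  · left
    push Not at hj
    have h1 : α = α k • e k := by
      ext j
      by_cases hjk : j = k
      · subst hjk; simp [e]
      · simp [e, hjk, hj j hjk]
    obtain ⟨v, hv, i, hi, hα⟩ := h
    have h2 : qf M α = 2 := by
      rw [hα, qf_rho]
      have := qf_smul_e (M := M) 1 i
      simpa using this
    rw [h1, qf_smul_e] at h2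
    have h3 : α k = 1 := by
      have := h0 k
      simp only [Pi.zero_apply] at this
      nlinarith
    rw [h1, h3, one_smul]

variable (cs)

theorem inv_finite (g : W) :
    {α : B → ℝ | IsRoot cs Set.univ α ∧ 0 ≤ α ∧ rho cs g α ≤ 0}.Finite := by
  induction g using cs.simple_induction_right with
  | one =>
    convert Set.finite_empty
    ext α
    simp only [Set.mem_ofPred_eq, Set.mem_empty_iff_false, iff_false]
    rintro ⟨h1, h2, h3⟩
    rw [rho_one] at h3
    exact h1.ne_zero (le_antisymm h3 h2)
  | mul_simple_right g i ih =>
    refine ((ih.image (rho cs (cs.simple i))).union (Set.finite_singleton (e i))).subset ?_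
    rintro α ⟨h1, h2, h3⟩
    rcases h1.simple_pos h2 i with h | h
    · right; exact h
    · left
      refine ⟨rho cs (cs.simple i) α, ⟨h1.rho (mem_parabolic_univ cs _), h, ?_⟩, ?_⟩
      · rwa [rho_mul] at h3
      · rw [← rho_mul, cs.simple_mul_simple_self, rho_one]

theorem dual_sum (ν : (B → ℝ) →ₗ[ℝ] ℝ) (x : B → ℝ) : ν x = ∑ i, x i * ν (e i) := by
  have : x = ∑ i, x i • e i := by
    ext j
    simp [e, Finset.sum_apply, Pi.single_apply]
  conv_lhs => rw [this]
  simp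

theorem dual_nonneg {ν : (B → ℝ) →ₗ[ℝ] ℝ} (hν : ∀ i, 0 ≤ ν (e i)) {x : B → ℝ} (hx : 0 ≤ x) :
    0 ≤ ν x := by
  rw [dual_sum]
  exact Finset.sum_nonneg fun i _ => mul_nonneg (hx i) (hν i)

theorem stab {ν : (B → ℝ) →ₗ[ℝ] ℝ} (hν : ∀ i, 0 ≤ ν (e i)) (n : ℕ) :
    ∀ g : W, cs.length g = n → (∀ x, ν (rho cs g x) = ν x) →
      g ∈ cs.parabolic {i | ν (e i) = 0} := by
  induction n with
  | zero =>
    intro g hg _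
    rw [cs.length_eq_zero_iff.1 hg]; exact one_mem _
  | succ n ih =>
    intro g hg hf
    have hg1 : g ≠ 1 := by rintro rfl; simp at hg
    obtain ⟨i, hi⟩ := cs.exists_rightDescent_of_ne_one hg1
    have h1 := neg_of_desc cs hi
    have h2 : 0 ≤ ν (-(rho cs g (e i))) := dual_nonneg hν (by simpa using h1)
    rw [map_neg, hf] at h2
    have h3 : ν (e i) = 0 := le_antisymm (by linarith) (hν i)
    have h4 := ih (g * cs.simple i) (by have := cs.isRightDescent_iff.1 hi; omega) (fun x => by
      rw [rho_mul, hf, rho_simple_apply, map_sub, map_smul, h3, smul_zero, sub_zero])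
    have h5 := mul_mem h4 (simple_mem_parabolic cs (T := {i | ν (e i) = 0}) h3)
    rwa [cs.simple_mul_simple_cancel_right] at h5

theorem parabolic_fix {T : Set B} {ν : (B → ℝ) →ₗ[ℝ] ℝ} (hν : ∀ i ∈ T, ν (e i) = 0) {g : W}
    (hg : g ∈ cs.parabolic T) : ∀ x, ν (rho cs g x) = ν x := by
  unfold CoxeterSystem.parabolic at hg
  induction hg using Subgroup.closure_induction with
  | mem y hy =>
    obtain ⟨i, hi, rfl⟩ := hy
    intro x
    rw [rho_simple_apply, map_sub, map_smul, hν i hi, smul_zero, sub_zero]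
  | one => intro x; rw [rho_one]
  | mul a b _ _ ha hb => intro x; rw [rho_mul, ha, hb]
  | inv a _ ha => intro x; rw [← ha, rho_self_inv]

theorem to_chamber (T : Set B) (n : ℕ) : ∀ μ : (B → ℝ) →ₗ[ℝ] ℝ,
    {α : B → ℝ | IsRoot cs T α ∧ 0 ≤ α ∧ μ α < 0}.Finite →
    {α : B → ℝ | IsRoot cs T α ∧ 0 ≤ α ∧ μ α < 0}.ncard = n →
    ∃ w ∈ cs.parabolic T, ∀ i ∈ T, 0 ≤ μ (rho cs w (e i)) := by
  induction n using Nat.strong_induction_on with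
  | _ n IH =>
  intro μ hfin hn
  by_cases hall : ∀ i ∈ T, 0 ≤ μ (e i)
  · exact ⟨1, one_mem _, fun i hi => by rw [rho_one]; exact hall i hi⟩
  push Not at hall
  obtain ⟨i, hi, hneg⟩ := hall
  have hsub : {α : B → ℝ | IsRoot cs T α ∧ 0 ≤ α ∧ (μ ∘ₗ rho cs (cs.simple i)) α < 0} ⊆
      (rho cs (cs.simple i)) '' ({α : B → ℝ | IsRoot cs T α ∧ 0 ≤ α ∧ μ α < 0} \ {e i}) := by
    rintro α ⟨h1, h2, h3⟩
    rw [LinearMap.comp_apply] at h3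
    have h4 : rho cs (cs.simple i) (e i) = - e i := by
      rw [rho_simple_apply, cor_e, cf_self, two_smul]; abel
    have h5 : rho cs (cs.simple i) (rho cs (cs.simple i) α) = α := by
      rw [← rho_mul, cs.simple_mul_simple_self, rho_one]
    rcases h1.simple_pos h2 i with h | h
    · rw [h, h4, map_neg] at h3; linarith
    · refine ⟨rho cs (cs.simple i) α,
        ⟨⟨h1.rho (simple_mem_parabolic cs hi), h, h3⟩, fun heq => ?_⟩, h5⟩
      rw [Set.mem_singleton_iff] at heq
      rw [heq, h4] at h5
      rw [← h5] at h2
      exact e_ne_zero i (le_antisymm (by simpa using h2) (e_nonneg i))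
  have hmem : e i ∈ {α : B → ℝ | IsRoot cs T α ∧ 0 ≤ α ∧ μ α < 0} :=
    ⟨isRoot_e hi, e_nonneg i, hneg⟩
  have hfin2 := (hfin.subset (Set.sdiff_subset (t := {e i})))
  have hfin' := (hfin2.image (rho cs (cs.simple i))).subset hsub
  have hlt : {α : B → ℝ | IsRoot cs T α ∧ 0 ≤ α ∧ (μ ∘ₗ rho cs (cs.simple i)) α < 0}.ncard < n := by
    calc _ ≤ _ := Set.ncard_le_ncard hsub (hfin2.image _)
      _ ≤ _ := Set.ncard_image_le hfin2
      _ < _ := Set.ncard_sdiff_singleton_lt_of_mem hmem hfin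
      _ = n := hn
  obtain ⟨w, hw, hw2⟩ := IH _ hlt _ hfin' rfl
  refine ⟨cs.simple i * w, mul_mem (simple_mem_parabolic cs hi) hw, fun j hj => ?_⟩
  rw [rho_mul]
  exact hw2 j hj

theorem sum_pos_of {x : B → ℝ} (h : 0 ≤ x) (h0 : x ≠ 0) : 0 < ∑ i, x i := by
  obtain ⟨i, hi⟩ := Function.ne_iff.1 h0
  exact Finset.sum_pos' (fun i _ => h i) ⟨i, Finset.mem_univ _, lt_of_le_of_ne (h i) (Ne.symm hi)⟩

/-- A finite subgroup is contained in a conjugate of a spherical parabolic subgroup. -/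
theorem finite_subgroup (F : Subgroup W) (hF : (F : Set W).Finite) :
    ∃ (w : W) (T : Set B), cs.IsSpherical T ∧ ∀ f ∈ F, w⁻¹ * f * w ∈ cs.parabolic T := by
  have : Fintype F := hF.fintype
  let lam : (B → ℝ) →ₗ[ℝ] ℝ := ∑ i, LinearMap.proj i
  have hlam : ∀ x, lam x = ∑ i, x i := fun x => by simp [lam]
  let μ : (B → ℝ) →ₗ[ℝ] ℝ := ∑ f : F, lam ∘ₗ rho cs f
  have hμ : ∀ x, μ x = ∑ f : F, lam (rho cs f x) := fun x => by
    simp [μ]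
  have hinv : ∀ f ∈ F, ∀ x, μ (rho cs f x) = μ x := by
    intro f hf x
    rw [hμ, hμ]
    refine Fintype.sum_equiv (Equiv.mulRight (⟨f, hf⟩ : F)) _ _ fun g => ?_
    simp [rho_mul]
  have key : ∀ w : W, {α : B → ℝ | IsRoot cs Set.univ α ∧ 0 ≤ α ∧ μ (rho cs w α) ≤ 0}.Finite := by
    intro w
    refine (Set.finite_iUnion fun f : F => inv_finite cs (f * w)).subset ?_
    rintro α ⟨h1, h2, h3⟩
    rw [hμ] at h3
    obtain ⟨f, hf⟩ : ∃ f : F, lam (rho cs f (rho cs w α)) ≤ 0 := by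
      by_contra hcon
      push Not at hcon
      exact absurd h3 (not_le.2 (Finset.sum_pos (fun f _ => hcon f) ⟨1, Finset.mem_univ _⟩))
    rw [Set.mem_iUnion]
    refine ⟨f, h1, h2, ?_⟩
    rw [← rho_mul] at hf
    have hr := h1.rho (mem_parabolic_univ cs ((f : W) * w))
    refine hr.pm.resolve_left fun hp => ?_
    have := sum_pos_of hp hr.ne_zero
    rw [hlam] at hf
    linarith
  have hfin1 : {α : B → ℝ | IsRoot cs Set.univ α ∧ 0 ≤ α ∧ μ α < 0}.Finite := by
    refine (key 1).subset ?_
    rintro α ⟨h1, h2, h3⟩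
    exact ⟨h1, h2, by rw [rho_one]; exact h3.le⟩
  obtain ⟨w, -, hw⟩ := to_chamber cs Set.univ _ μ hfin1 rfl
  let ν : (B → ℝ) →ₗ[ℝ] ℝ := μ ∘ₗ rho cs w
  have hν : ∀ i, 0 ≤ ν (e i) := fun i => hw i trivial
  refine ⟨w, {i | ν (e i) = 0}, ?_, fun f hf => ?_⟩
  · have hZ : {α : B → ℝ | IsRoot cs Set.univ α ∧ 0 ≤ α ∧ ν α ≤ 0}.Finite := key w
    unfold CoxeterSystem.IsSpherical
    let N : W → Set (B → ℝ) := fun g => {α | IsRoot cs Set.univ α ∧ 0 ≤ α ∧ rho cs g α ≤ 0}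
    have hNinj : Function.Injective N := by
      intro g h hgh
      have hstep : ∀ β, IsRoot cs Set.univ β → 0 ≤ β → (rho cs g β ≤ 0 ↔ rho cs h β ≤ 0) := by
        intro β h1 h2
        have : β ∈ N g ↔ β ∈ N h := by rw [hgh]
        simpa [N, h1, h2] using this
      have : g * h⁻¹ = 1 := by
        apply eq_one_of_pos cs
        intro i
        have hb : IsRoot cs Set.univ (rho cs h⁻¹ (e i)) :=
          (isRoot_e (Set.mem_univ i)).rho (mem_parabolic_univ cs _)
        have hg : IsRoot cs Set.univ (rho cs g (rho cs h⁻¹ (e i))) :=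
          hb.rho (mem_parabolic_univ cs _)
        have hi : IsRoot cs Set.univ (e i) := isRoot_e trivial
        rw [rho_mul]
        rcases hb.pm with hp | hp
        · refine hg.pm.resolve_right fun hn => ?_
          rw [hstep _ hb hp, rho_self_inv] at hn
          exact e_ne_zero i (le_antisymm hn (e_nonneg i))
        · -- negative case
          have hneg : IsRoot cs Set.univ (-(rho cs h⁻¹ (e i))) := by
            refine ⟨h⁻¹ * cs.simple i, mem_parabolic_univ cs _, i, trivial, ?_⟩
            rw [rho_mul, rho_simple_apply, cor_e, cf_self, two_smul, sub_add_cancel_left, map_neg]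
          have := (hstep _ hneg (by simpa using hp)).2
            (by rw [map_neg, rho_self_inv]; simpa using e_nonneg i)
          rw [map_neg] at this
          simpa using this
      exact mul_inv_eq_one.1 this
    refine Set.Finite.of_finite_image (f := N) (hZ.finite_subsets.subset ?_) hNinj.injOn
    rintro _ ⟨g, hg, rfl⟩ α ⟨h1, h2, h3⟩
    refine ⟨h1, h2, ?_⟩
    rw [← parabolic_fix cs (T := {i | ν (e i) = 0}) (fun i hi => hi) hg α]
    have := dual_nonneg hν (x := -(rho cs g α)) (by simpa using h3)
    rw [map_neg] at this
    linarith
  · refine stab cs hν _ _ rfl fun x => ?_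
    change μ (rho cs w (rho cs (w⁻¹ * f * w) x)) = μ (rho cs w x)
    rw [← rho_mul, show w * (w⁻¹ * f * w) = f * w by group, rho_mul, hinv f hf]

/-- Elements moving vectors only in directions of `P`. -/
def dirSub (P : Submodule ℝ (B → ℝ)) : Subgroup W where
  carrier := {g | ∀ x, rho cs g x - x ∈ P}
  one_mem' := fun x => by rw [rho_one, sub_self]; exact P.zero_mem
  mul_mem' := fun {a b} ha hb x => by
    have := P.add_mem (ha (rho cs b x)) (hb x)
    rwa [← rho_mul, sub_add_sub_cancel] at this
  inv_mem' := fun {a} ha x => by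
    have := P.neg_mem (ha (rho cs a⁻¹ x))
    rwa [rho_self_inv, neg_sub] at this

theorem mem_dirSub {P : Submodule ℝ (B → ℝ)} {g : W} :
    g ∈ dirSub cs P ↔ ∀ x, rho cs g x - x ∈ P := Iff.rfl

theorem e_mem_of_simple {P : Submodule ℝ (B → ℝ)} {i : B} (h : cs.simple i ∈ dirSub cs P) :
    e i ∈ P := by
  have := (mem_dirSub cs).1 h (e i)
  rw [rho_simple_apply, cor_e, cf_self, sub_sub_cancel_left] at this
  have h2 := P.smul_mem (-(1/2 : ℝ)) this
  simpa using h2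

/-- A reflection has a root. -/
theorem refl_root {t : W} (ht : cs.IsReflection t) :
    ∃ (α : B → ℝ) (f : (B → ℝ) →ₗ[ℝ] ℝ), ∀ x, rho cs t x = x - f x • α := by
  obtain ⟨w, i, rfl⟩ := ht
  refine ⟨rho cs w (e i), cor M i ∘ₗ rho cs w⁻¹, fun x => ?_⟩
  rw [rho_mul, rho_mul, rho_simple_apply, map_sub, rho_self_inv, map_smul, LinearMap.comp_apply]

end CoxGeo
namespace CoxGeo

variable {B : Type*} [Fintype B] [DecidableEq B]
variable {W : Type*} [Group W] {M : CoxeterMatrix B} (cs : CoxeterSystem M W)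

theorem card_le_of_e_mem {P : Submodule ℝ (B → ℝ)} (X : Finset B) (h : ∀ i ∈ X, e i ∈ P) :
    X.card ≤ Module.finrank ℝ P := by
  have hli : LinearIndependent ℝ (fun i : X => (e (i : B) : B → ℝ)) := by
    have h0 := (Pi.basisFun ℝ B).linearIndependent
    have h1 := h0.comp (fun i : X => (i : B)) Subtype.val_injective
    convert h1 using 1
    ext i j
    simp [e]
  have h2 := finrank_span_eq_card hli
  rw [Fintype.card_coe] at h2
  rw [← h2]
  apply Submodule.finrank_mono
  rw [Submodule.span_le]
  rintro _ ⟨i, rfl⟩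
  exact h i i.2

theorem exists_dual (c : B → ℝ) : ∃ ν : (B → ℝ) →ₗ[ℝ] ℝ, ∀ i, ν (e i) = c i := by
  refine ⟨Fintype.linearCombination ℝ c, fun i => ?_⟩
  rw [Fintype.linearCombination_apply, Finset.sum_eq_single i]
  · simp [e]
  · intro j _ hj; simp [e, hj]
  · simp

theorem parabolic_mono {T T' : Set B} (h : T ⊆ T') : cs.parabolic T ≤ cs.parabolic T' :=
  Subgroup.closure_mono (Set.image_mono h)

theorem sph_mono {T T' : Set B} (h : T ⊆ T') (hs : cs.IsSpherical T') : cs.IsSpherical T :=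
  Set.Finite.subset hs (parabolic_mono cs h)

theorem root_finite {T : Set B} (hs : cs.IsSpherical T) : {α | IsRoot cs T α}.Finite := by
  have : {α | IsRoot cs T α} ⊆
      (fun p : W × B => rho cs p.1 (e p.2)) '' ((cs.parabolic T : Set W) ×ˢ Set.univ) := by
    rintro _ ⟨w, hw, i, _, rfl⟩
    exact ⟨(w, i), ⟨hw, trivial⟩, rfl⟩
  exact ((Set.Finite.prod hs Set.finite_univ).image _).subset this

theorem step {T : Set B} (hs : cs.IsSpherical T) {q r : W} (hq : cs.IsReflection q)
    (hr : cs.IsReflection r) (hqT : q ∈ cs.parabolic T) (hrT : r ∈ cs.parabolic T)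
    (hT : 3 ≤ T.ncard) :
    ∃ w ∈ cs.parabolic T, ∃ T1, T1 ⊂ T ∧ w⁻¹ * q * w ∈ cs.parabolic T1 ∧
      w⁻¹ * r * w ∈ cs.parabolic T1 := by
  classical
  obtain ⟨α, f, hα⟩ := refl_root cs hq
  obtain ⟨β, g, hβ⟩ := refl_root cs hr
  let P := Submodule.span ℝ (({α, β} : Finset (B → ℝ)) : Set (B → ℝ))
  have hP : Module.finrank ℝ P ≤ 2 :=
    (finrank_span_finset_le_card (R := ℝ) ({α, β} : Finset (B → ℝ))).trans Finset.card_le_two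
  have hαP : α ∈ P := Submodule.subset_span (by simp)
  have hβP : β ∈ P := Submodule.subset_span (by simp)
  obtain ⟨i, hiT, hi⟩ : ∃ i ∈ T, e i ∉ P := by
    by_contra hcon
    push Not at hcon
    have := card_le_of_e_mem (P := P) T.toFinset (by simpa using hcon)
    rw [← Set.ncard_eq_toFinset_card'] at this
    omega
  obtain ⟨μ, hμi, hμP⟩ := Submodule.exists_le_ker_of_notMem hi
  have hfin : {α : B → ℝ | IsRoot cs T α ∧ 0 ≤ α ∧ μ α < 0}.Finite :=
    (root_finite cs hs).subset (fun _ h => h.1)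
  obtain ⟨w, hw, hpos⟩ := to_chamber cs T _ μ hfin rfl
  let μ1 : (B → ℝ) →ₗ[ℝ] ℝ := μ ∘ₗ rho cs w
  have hμ1 : ∀ x, μ1 x = μ (rho cs w x) := fun x => rfl
  obtain ⟨μ2, hμ2⟩ := exists_dual (fun i => if i ∈ T then μ1 (e i) else 1)
  have hd : ∀ i ∈ T, (μ2 - μ1) (e i) = 0 := by
    intro i hi
    rw [LinearMap.sub_apply, hμ2, if_pos hi, sub_self]
  have hnn : ∀ i, 0 ≤ μ2 (e i) := by
    intro i
    rw [hμ2]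
    split_ifs with h
    · exact hpos i h
    · exact zero_le_one
  have key : ∀ t ∈ cs.parabolic T, (∀ x, μ (rho cs t x) = μ x) →
      w⁻¹ * t * w ∈ cs.parabolic {i | μ2 (e i) = 0} := by
    intro t ht hfix
    have hm : w⁻¹ * t * w ∈ cs.parabolic T := mul_mem (mul_mem (inv_mem hw) ht) hw
    refine stab cs hnn _ _ rfl fun x => ?_
    have h1 := parabolic_fix cs hd hm x
    have h2 : μ1 (rho cs (w⁻¹ * t * w) x) = μ1 x := by
      rw [hμ1, hμ1, ← rho_mul, show w * (w⁻¹ * t * w) = t * w by group, rho_mul, hfix]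
    simp only [LinearMap.sub_apply] at h1
    linarith
  have hμα : μ α = 0 := hμP hαP
  have hμβ : μ β = 0 := hμP hβP
  refine ⟨w, hw, {i | μ2 (e i) = 0}, ?_, key q hqT ?_, key r hrT ?_⟩
  · have hsub : {i | μ2 (e i) = 0} ⊆ T := by
      intro j hj
      by_contra hjT
      have : μ2 (e j) = 0 := hj
      rw [hμ2, if_neg hjT] at this
      exact one_ne_zero this
    refine ⟨hsub, fun hsup => hμi ?_⟩
    have hz : ∀ j ∈ T, μ1 (e j) = 0 := by
      intro j hj
      have : μ2 (e j) = 0 := hsup hj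
      rwa [hμ2, if_pos hj] at this
    have h1 := parabolic_fix cs hz (inv_mem hw) (e i)
    rw [hμ1, rho_self_inv, hz i hiT] at h1
    exact h1
  · intro x; rw [hα, map_sub, map_smul, hμα]; simp
  · intro x; rw [hβ, map_sub, map_smul, hμβ]; simp

theorem isRefl_conj {t : W} (ht : cs.IsReflection t) (w : W) : cs.IsReflection (w⁻¹ * t * w) := by
  have := ht.conj w⁻¹
  rwa [inv_inv] at this

theorem rank2 (n : ℕ) : ∀ T : Set B, T.ncard = n → cs.IsSpherical T → ∀ q r : W,
    cs.IsReflection q → cs.IsReflection r → q ∈ cs.parabolic T → r ∈ cs.parabolic T →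
    ∃ v : W, ∃ T1 ⊆ T, T1.ncard ≤ 2 ∧ v⁻¹ * q * v ∈ cs.parabolic T1 ∧
      v⁻¹ * r * v ∈ cs.parabolic T1 := by
  induction n using Nat.strong_induction_on with
  | _ n IH =>
  intro T hn hs q r hq hr hqT hrT
  by_cases h3 : 3 ≤ T.ncard
  · obtain ⟨w, hw, T1, hT1, h1, h2⟩ := step cs hs hq hr hqT hrT h3
    obtain ⟨v, T2, hT2, hc, h4, h5⟩ := IH T1.ncard (hn ▸ Set.ncard_lt_ncard hT1 (Set.toFinite _))
      T1 rfl (sph_mono cs hT1.1 hs) _ _ (isRefl_conj cs hq w) (isRefl_conj cs hr w) h1 h2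
    refine ⟨w * v, T2, hT2.trans hT1.1, hc, ?_, ?_⟩
    · convert h4 using 1; group
    · convert h5 using 1; group
  · exact ⟨1, T, le_rfl, by omega, by simpa using hqT, by simpa using hrT⟩

variable {B' : Type*} [Fintype B'] [DecidableEq B']
variable {W' : Type*} [Group W'] {M' : CoxeterMatrix B'} (cs' : CoxeterSystem M' W')

theorem dirLemma (ψ : W →* W') (hψ : ∀ w, cs.IsReflection w → cs'.IsReflection (ψ w))
    (T : Set B) : ∃ P : Submodule ℝ (B' → ℝ), Module.finrank ℝ P ≤ T.ncard ∧
      ∀ g ∈ cs.parabolic T, ψ g ∈ dirSub cs' P := by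
  classical
  choose α f h using fun i => refl_root cs' (hψ _ (cs.isReflection_simple i))
  refine ⟨Submodule.span ℝ ((T.toFinset.image α : Finset (B' → ℝ)) : Set (B' → ℝ)), ?_, ?_⟩
  · refine (finrank_span_finset_le_card (R := ℝ) (T.toFinset.image α)).trans ?_
    rw [Set.ncard_eq_toFinset_card']
    exact Finset.card_image_le
  · have : cs.parabolic T ≤ (dirSub cs'
        (Submodule.span ℝ ((T.toFinset.image α : Finset (B' → ℝ)) : Set (B' → ℝ)))).comap ψ := by
      unfold CoxeterSystem.parabolic
      rw [Subgroup.closure_le]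
      rintro _ ⟨i, hi, rfl⟩
      intro x
      rw [h, sub_sub_cancel_left]
      refine Submodule.neg_mem _ (Submodule.smul_mem _ _ (Submodule.subset_span ?_))
      simp only [Finset.coe_image, Set.coe_toFinset]
      exact ⟨i, hi, rfl⟩
    exact fun g hg => this hg

theorem conj_of_odd {i j : B} (h : Odd (M i j)) :
    ∃ w, w * cs.simple i * w⁻¹ = cs.simple j := by
  obtain ⟨k, hk⟩ := h
  have h1 := cs.simple_mul_simple_pow i j
  rw [hk] at h1
  have hinv : ∀ n : ℕ, cs.simple i * ((cs.simple i * cs.simple j) ^ n)⁻¹ =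
      (cs.simple i * cs.simple j) ^ n * cs.simple i := by
    intro n
    induction n with
    | zero => simp
    | succ n ih =>
      rw [pow_succ, mul_inv_rev, mul_inv_rev, cs.inv_simple, cs.inv_simple]
      have : cs.simple i * (cs.simple j * cs.simple i * ((cs.simple i * cs.simple j) ^ n)⁻¹) =
        (cs.simple i * cs.simple j) * (cs.simple i * ((cs.simple i * cs.simple j) ^ n)⁻¹) := by
        group
      rw [this, ih, ← mul_assoc, ← pow_succ', pow_succ]
  refine ⟨(cs.simple i * cs.simple j) ^ k, ?_⟩
  rw [mul_assoc, hinv, ← mul_assoc, ← pow_add, ← two_mul]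
  rw [pow_succ, ← mul_assoc] at h1
  have := eq_inv_of_mul_eq_one_left h1
  rwa [cs.inv_simple] at this

theorem exists_char (i : B) : ∃ χ : W →* ℤˣ, χ (cs.simple i) = -1 ∧
    ∀ j, χ (cs.simple j) ≠ 1 → ∃ w, w * cs.simple i * w⁻¹ = cs.simple j := by
  classical
  let f : B → ℤˣ := fun j => if ∃ w, w * cs.simple i * w⁻¹ = cs.simple j then -1 else 1
  have hf : M.IsLiftable f := by
    intro a b
    rcases Nat.even_or_odd (M a b) with he | ho
    · rcases Int.units_eq_one_or (f a * f b) with h | h <;> rw [h]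
      · simp
      · exact he.neg_one_pow
    · obtain ⟨w, hw⟩ := conj_of_odd cs ho
      have : f a = f b := by
        simp only [f]
        congr 1
        apply propext
        constructor
        · rintro ⟨v, hv⟩
          refine ⟨w * v, ?_⟩
          rw [← hw, ← hv]; group
        · rintro ⟨v, hv⟩
          refine ⟨w⁻¹ * v, ?_⟩
          rw [← hw] at hv
          have : cs.simple a = w⁻¹ * (w * cs.simple a * w⁻¹) * w := by group
          rw [this, ← hv]; group
      rw [this, Int.units_mul_self, one_pow]
  refine ⟨cs.lift ⟨f, hf⟩, ?_, fun j hj => ?_⟩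
  · rw [cs.lift_apply_simple]
    exact if_pos ⟨1, by simp⟩
  · rw [cs.lift_apply_simple] at hj
    by_contra hc
    exact hj (if_neg hc)

theorem reverse_refl (φ : W ≃* W') (hφ : ∀ w, cs.IsReflection w → cs'.IsReflection (φ w))
    (i : B') : cs.IsReflection (φ.symm (cs'.simple i)) := by
  obtain ⟨χ, hχ, hj⟩ := exists_char cs' i
  have : ∃ a, χ (φ (cs.simple a)) ≠ 1 := by
    by_contra hc
    push Not at hc
    have : χ.comp φ.toMonoidHom = 1 := cs.ext_simple (by intro a; simpa using hc a)
    have h2 := DFunLike.congr_fun this (φ.symm (cs'.simple i))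
    simp [hχ] at h2
  obtain ⟨a, ha⟩ := this
  obtain ⟨w, j, hwj⟩ := hφ _ (cs.isReflection_simple a)
  rw [hwj] at ha
  obtain ⟨v, hv⟩ := hj j (by intro h; apply ha; simp [h])
  rw [← hv] at hwj
  have : φ.symm (cs'.simple i) = φ.symm (w * v)⁻¹ * cs.simple a * (φ.symm (w * v)⁻¹)⁻¹ := by
    apply φ.injective
    simp only [map_mul, map_inv, MulEquiv.apply_symm_apply, hwj]
    group
  rw [this]
  exact (cs.isReflection_simple a).conj _

theorem dihedral {s t : W} (hs : s * s = 1) (ht : t * t = 1) {g : W}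
    (hg : g ∈ Subgroup.closure {s, t}) : ∃ z : ℤ, g = (s * t) ^ z ∨ g = (s * t) ^ z * s := by
  have hs' : s⁻¹ = s := inv_eq_of_mul_eq_one_left hs
  have ht' : t⁻¹ = t := inv_eq_of_mul_eq_one_left ht
  have hc : s * (s * t) * s⁻¹ = (s * t)⁻¹ := by
    rw [mul_inv_rev, hs', ht', ← mul_assoc, hs, one_mul]
  have hcz : ∀ z : ℤ, s * (s * t) ^ z = (s * t) ^ (-z) * s := by
    intro z
    have h1 : s * (s * t) ^ z * s⁻¹ = (s * t) ^ (-z) := by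
      rw [← conj_zpow, hc, inv_zpow, zpow_neg]
    rw [← h1, inv_mul_cancel_right]
  have htt : t = (s * t) ^ (-1 : ℤ) * s := by
    rw [zpow_neg, zpow_one, mul_inv_rev, hs', ht', mul_assoc, hs, mul_one]
  induction hg using Subgroup.closure_induction with
  | mem x hx =>
    rcases hx with rfl | hx
    · exact ⟨0, Or.inr (by simp)⟩
    · rw [Set.mem_singleton_iff] at hx
      exact ⟨-1, Or.inr (by rw [hx]; exact htt)⟩
  | one => exact ⟨0, Or.inl (by simp)⟩
  | mul x y _ _ hx hy =>
    obtain ⟨a, ha⟩ := hx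
    obtain ⟨b, hb⟩ := hy
    rcases ha with rfl | rfl <;> rcases hb with rfl | rfl
    · exact ⟨a + b, Or.inl (by rw [zpow_add])⟩
    · exact ⟨a + b, Or.inr (by rw [zpow_add, mul_assoc])⟩
    · exact ⟨a - b, Or.inr (by rw [mul_assoc, hcz, ← mul_assoc, ← zpow_add, sub_eq_add_neg])⟩
    · refine ⟨a - b, Or.inl ?_⟩
      rw [mul_assoc, ← mul_assoc s, hcz, mul_assoc _ s s, hs, mul_one, ← zpow_add, sub_eq_add_neg]
  | inv x _ hx =>
    obtain ⟨a, ha⟩ := hx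
    rcases ha with rfl | rfl
    · exact ⟨-a, Or.inl (by rw [zpow_neg])⟩
    · refine ⟨a, Or.inr ?_⟩
      rw [mul_inv_rev, hs', ← zpow_neg, hcz, neg_neg]

theorem parabolic_pair (i j : B) : cs.parabolic {i, j} =
    Subgroup.closure {cs.simple i, cs.simple j} := by
  unfold CoxeterSystem.parabolic
  rw [Set.image_pair]

theorem sph_pair {i j : B} (h : M i j ≠ 0) : cs.IsSpherical {i, j} := by
  unfold CoxeterSystem.IsSpherical
  have hf : ((Subgroup.zpowers (cs.simple i * cs.simple j) : Subgroup W) : Set W).Finite := by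
    rw [finite_zpowers, isOfFinOrder_iff_pow_eq_one]
    exact ⟨M i j, Nat.pos_of_ne_zero h, cs.simple_mul_simple_pow i j⟩
  refine (hf.union (hf.image (· * cs.simple i))).subset ?_
  intro g hg
  rw [parabolic_pair] at hg
  obtain ⟨z, hz | hz⟩ := dihedral (cs.simple_mul_simple_self i) (cs.simple_mul_simple_self j) hg
  · exact Or.inl ⟨z, hz.symm⟩
  · exact Or.inr ⟨_, ⟨z, rfl⟩, hz.symm⟩

theorem dvd_of_pow {a b : B} (hab : a ≠ b) {n : ℕ} (h : (cs.simple a * cs.simple b) ^ n = 1) :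
    M a b ∣ n := by
  have h1 := sig_pow_e M hab n
  rw [← rho_simple cs, ← rho_simple cs, ← map_mul, ← map_pow, h, rho_one] at h1
  have ha := congrFun h1 a
  have hb := congrFun h1 b
  simp [e, Pi.single_apply, hab, hab.symm] at ha hb
  exact dvd_of_U (M.off_diagonal a b hab) hb.symm ha.symm

theorem refl_in_pair {i j : B} {t : W} (ht : cs.IsReflection t) (h : t ∈ cs.parabolic {i, j}) :
    ∃ z : ℤ, t = (cs.simple i * cs.simple j) ^ z * cs.simple i := by
  rw [parabolic_pair] at h
  obtain ⟨z, hz | hz⟩ := dihedral (cs.simple_mul_simple_self i) (cs.simple_mul_simple_self j) h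
  · exfalso
    have h1 : cs.lengthParity t = 1 := by
      rw [hz, map_zpow, map_mul, cs.lengthParity_simple, cs.lengthParity_simple]
      have : (Multiplicative.ofAdd (1 : ZMod 2)) * Multiplicative.ofAdd 1 = 1 := by decide
      rw [this, one_zpow]
    obtain ⟨w, k, hk⟩ := ht
    rw [hk, map_mul, map_mul, map_inv, mul_inv_cancel_comm, cs.lengthParity_simple] at h1
    exact absurd h1 (by decide)
  · exact ⟨z, hz⟩

end CoxGeo
namespace CoxGeo

variable {B : Type*} [Fintype B] [DecidableEq B]
variable {W : Type*} [Group W] {M : CoxeterMatrix B} (cs : CoxeterSystem M W)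
variable {B' : Type*} [Fintype B'] [DecidableEq B']
variable {W' : Type*} [Group W'] {M' : CoxeterMatrix B'} (cs' : CoxeterSystem M' W')

/-- The map `x ↦ φ (w x w⁻¹)`. -/
def tw (φ : W ≃* W') (w : W) : W →* W' := φ.toMonoidHom.comp (MulAut.conj w).toMonoidHom

theorem tw_apply (φ : W ≃* W') (w x : W) : tw φ w x = φ (w * x * w⁻¹) := rfl

theorem main_aux (φ : W ≃* W')
    (hφ : ∀ w : W, cs.IsReflection w → cs'.IsReflection (φ w))
    (h1 : ∀ i j : B, i ≠ j → Odd (M i j) → cs.IsMaxSpherical {i, j})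
    {i j k : B'} (hij : i ≠ j) (hodd : Odd (M' i j)) {V : Set B'} (hV : cs'.IsSpherical V)
    (hi : i ∈ V) (hj : j ∈ V) (hk : k ∈ V) (hki : k ≠ i) (hkj : k ≠ j) : False := by
  have hre := reverse_refl cs cs' φ hφ
  have htw : ∀ w x : W, cs.IsReflection x → cs'.IsReflection (tw φ w x) := by
    intro w x hx
    exact hφ _ (hx.conj w)
  have hF : (((cs'.parabolic V).comap φ.toMonoidHom : Subgroup W) : Set W).Finite :=
    by
      have h0 : ((φ : W → W') ⁻¹' (cs'.parabolic V : Set W')).Finite :=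
        Set.Finite.preimage φ.injective.injOn hV
      refine h0.subset fun x hx => ?_
      exact Subgroup.mem_comap.1 hx
  obtain ⟨w, T, hT, hw⟩ := finite_subgroup cs _ hF
  have hmem : ∀ a ∈ V, w⁻¹ * φ.symm (cs'.simple a) * w ∈ cs.parabolic T := by
    intro a ha
    apply hw
    rw [Subgroup.mem_comap]
    change φ (φ.symm (cs'.simple a)) ∈ cs'.parabolic V
    rw [φ.apply_symm_apply]
    exact simple_mem_parabolic cs' ha
  obtain ⟨v, T1, hT1, hc, hq, hr⟩ := rank2 cs _ T rfl hT _ _ (isRefl_conj cs (hre i) w)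
    (isRefl_conj cs (hre j) w) (hmem i hi) (hmem j hj)
  obtain ⟨P, hP, hPd⟩ := dirLemma cs cs' (tw φ (w * v)) (htw _) T1
  have back : ∀ a, tw φ (w * v) (v⁻¹ * (w⁻¹ * φ.symm (cs'.simple a) * w) * v) = cs'.simple a := by
    intro a
    rw [tw_apply]
    have : w * v * (v⁻¹ * (w⁻¹ * φ.symm (cs'.simple a) * w) * v) * (w * v)⁻¹ =
      φ.symm (cs'.simple a) := by group
    rw [this, φ.apply_symm_apply]
  have hPi : e i ∈ P := e_mem_of_simple cs' (back i ▸ hPd _ hq)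
  have hPj : e j ∈ P := e_mem_of_simple cs' (back j ▸ hPd _ hr)
  have hcard := card_le_of_e_mem (P := P) {i, j} (by simp [hPi, hPj])
  rw [Finset.card_pair hij] at hcard
  have hT1c : T1.ncard = 2 := by omega
  obtain ⟨a, b, hab, rfl⟩ := Set.ncard_eq_two.1 hT1c
  rcases Nat.even_or_odd (M a b) with he | ho
  · -- even case
    let Q := Submodule.span ℝ (({e i, e j} : Finset (B' → ℝ)) : Set (B' → ℝ))
    have hQi : e i ∈ Q := Submodule.subset_span (by simp)
    have hQj : e j ∈ Q := Submodule.subset_span (by simp)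
    have hQP : Q ≤ P := by
      refine Submodule.span_le.2 ?_
      intro x hx
      simp only [Finset.coe_insert, Finset.coe_singleton, Set.mem_insert_iff,
        Set.mem_singleton_iff] at hx
      rcases hx with rfl | rfl
      · exact hPi
      · exact hPj
    have hQc := card_le_of_e_mem (P := Q) {i, j} (by simp [hQi, hQj])
    rw [Finset.card_pair hij] at hQc
    have hPQ : Q = P := Submodule.eq_of_le_of_finrank_le hQP (by omega)
    obtain ⟨ν, hν⟩ := exists_dual (fun l : B' => if l ∈ ({i, j} : Set B') then (0 : ℝ) else 1)
    have hνset : {l | ν (e l) = 0} = ({i, j} : Set B') := by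
      ext l
      rw [Set.mem_ofPred_eq, hν]
      split_ifs with h <;> simp [h]
    have hνP : P ≤ LinearMap.ker ν := by
      rw [← hPQ]
      refine Submodule.span_le.2 ?_
      intro x hx
      simp only [Finset.coe_insert, Finset.coe_singleton, Set.mem_insert_iff,
        Set.mem_singleton_iff] at hx
      rcases hx with rfl | rfl
      · change ν (e i) = 0; rw [hν]; simp
      · change ν (e j) = 0; rw [hν]; simp
    have key : ∀ c ∈ ({a, b} : Set B), ∃ z : ℤ, tw φ (w * v) (cs.simple c) =
        (cs'.simple i * cs'.simple j) ^ z * cs'.simple i := by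
      intro c hc
      apply refl_in_pair cs' (htw _ _ (cs.isReflection_simple c))
      rw [← hνset]
      refine stab cs' (fun l => ?_) _ _ rfl fun x => ?_
      · rw [hν]; split_ifs <;> norm_num
      · have : ν _ = 0 := hνP ((mem_dirSub cs').1 (hPd _ (simple_mem_parabolic cs hc)) x)
        rw [map_sub] at this
        linarith
    obtain ⟨y, hy⟩ := key a (by simp)
    obtain ⟨z, hz⟩ := key b (by simp)
    have hz' : tw φ (w * v) (cs.simple b) = cs'.simple i * (cs'.simple i * cs'.simple j) ^ (-z) := by
      rw [← (htw (w * v) _ (cs.isReflection_simple b)).inv, hz, mul_inv_rev, cs'.inv_simple, zpow_neg]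
    have hprod : tw φ (w * v) (cs.simple a * cs.simple b) =
        (cs'.simple i * cs'.simple j) ^ (y - z) := by
      rw [map_mul, hy, hz', mul_assoc, ← mul_assoc (cs'.simple i) (cs'.simple i),
        cs'.simple_mul_simple_self, one_mul, ← zpow_add, sub_eq_add_neg]
    have hpow : tw φ (w * v) ((cs.simple a * cs.simple b) ^ (M' i j)) = 1 := by
      rw [map_pow, hprod, ← zpow_natCast, zpow_comm, zpow_natCast, cs'.simple_mul_simple_pow,
        one_zpow]
    have hinj : Function.Injective (tw φ (w * v)) :=
      φ.injective.comp (MulAut.conj (w * v)).injective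
    have hpow2 : (cs.simple a * cs.simple b) ^ (M' i j) = 1 := hinj (hpow.trans (map_one _).symm)
    have hd := dvd_of_pow cs hab hpow2
    exact Nat.not_even_iff_odd.2 hodd (he.trans_dvd hd)
  · -- odd case
    have hTe : T = {a, b} := (h1 a b hab ho).2 T hT hT1
    obtain ⟨P2, hP2, hP2d⟩ := dirLemma cs cs' (tw φ w) (htw _) T
    have hall : ∀ l ∈ V, e l ∈ P2 := by
      intro l hl
      have h3 := hP2d _ (hmem l hl)
      have : tw φ w (w⁻¹ * φ.symm (cs'.simple l) * w) = cs'.simple l := by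
        rw [tw_apply]
        have : w * (w⁻¹ * φ.symm (cs'.simple l) * w) * w⁻¹ = φ.symm (cs'.simple l) := by group
        rw [this, φ.apply_symm_apply]
      rw [this] at h3
      exact e_mem_of_simple cs' h3
    have h4 := card_le_of_e_mem (P := P2) {k, i, j} (by simp [hall, hi, hj, hk])
    rw [Finset.card_eq_three.2 ⟨k, i, j, hki, hkj, hij, rfl⟩] at h4
    rw [hTe] at hP2
    omega

end CoxGeo
theorem maxSpherical_of_odd_image {B W B' W' : Type*} [Group W] [Group W'] [Finite B] [Finite B']
    {M : CoxeterMatrix B} {M' : CoxeterMatrix B'}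
    (cs : CoxeterSystem M W) (cs' : CoxeterSystem M' W')
    (φ : W ≃* W')
    (hφ : ∀ w : W, cs.IsReflection w → cs'.IsReflection (φ w))
    (h1 : ∀ i j : B, i ≠ j → Odd (M i j) → cs.IsMaxSpherical {i, j})
    (h2 : ¬ ∃ i j k : B, i ≠ j ∧ j ≠ k ∧ i ≠ k ∧ Odd (M i j) ∧ Odd (M j k))
    (h3 : ∀ i j : B, i ≠ j → Odd (M i j) →
      {T : Set B | cs.IsMaxSpherical T ∧ (T ∩ {i, j}).Nonempty}.ncard ≤ 2) :
    ∀ i' j' : B', i' ≠ j' → Odd (M' i' j') → cs'.IsMaxSpherical {i', j'} := by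
  classical
  have : Fintype B := Fintype.ofFinite B
  have : Fintype B' := Fintype.ofFinite B'
  intro i' j' hij hodd
  have hsph : cs'.IsSpherical {i', j'} := CoxGeo.sph_pair cs' (by rintro h; rw [h] at hodd; exact absurd hodd (by decide))
  refine ⟨hsph, fun V hV hsub => ?_⟩
  by_contra hne
  obtain ⟨k', hkV, hk⟩ : ∃ k' ∈ V, k' ∉ ({i', j'} : Set B') := by
    by_contra hc
    push Not at hc
    exact hne (Set.Subset.antisymm hc hsub)
  exact CoxGeo.main_aux cs cs' φ hφ h1 hij hodd hV (hsub (by simp)) (hsub (by simp)) hkV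
    (fun h => hk (by simp [h])) (fun h => hk (by simp [h]))
end
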